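/- arXiv:1210.4229 — 7 statements merged into one kernel-verified Lean document; each statement's English description precedes it below -/
import Mathlib

section
/- Let N ≥ 1 and let μ₁, μ₂ be real numbers with μ₁ > μ̄ ≥ 0 and μ₂ > μ̄. Then there exists a constant C > 0 such that for all x₁, x₂ ∈ ℝ^N one has ∫_{ℝ^N} e^{−μ₁|x−x₁|} · e^{−μ₂|x−x₂|} dx ≤ C · e^{−μ̄|x₁−x₂|}. -/
open MeasureTheory Real

theorem integrable_exp_neg_mul_norm {E : Type*} [NormedAddCommGroup E] [NormedSpace ℝ E]
    [FiniteDimensional ℝ E] [Nontrivial E] [MeasurableSpace E] [BorelSpace E]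
    (μ : Measure E) [μ.IsAddHaarMeasure] {c : ℝ} (hc : 0 < c) :
    Integrable (fun x : E ↦ Real.exp (-c * ‖x‖)) μ := by
  refine (integrable_fun_norm_addHaar μ (f := fun r : ℝ ↦ Real.exp (-c * r))).2 ?_
  have h := integrableOn_rpow_mul_exp_neg_mul_rpow
    (s := ((Module.finrank ℝ E - 1 : ℕ) : ℝ)) (p := 1) (b := c)
    (lt_of_lt_of_le (by norm_num) (Nat.cast_nonneg _)) one_pos hc
  simpa only [rpow_natCast, rpow_one, smul_eq_mul] using h

theorem stmt_0 (N : ℕ) (hN : 1 ≤ N) (μbar μ₁ μ₂ : ℝ)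
    (hμbar : 0 ≤ μbar) (h₁ : μbar < μ₁) (h₂ : μbar < μ₂) :
    ∃ C > (0 : ℝ), ∀ x₁ x₂ : EuclideanSpace ℝ (Fin N),
      (∫ x : EuclideanSpace ℝ (Fin N),
          Real.exp (-μ₁ * dist x x₁) * Real.exp (-μ₂ * dist x x₂))
        ≤ C * Real.exp (-μbar * dist x₁ x₂) := by
  have : Nonempty (Fin N) := ⟨⟨0, hN⟩⟩
  have hint := integrable_exp_neg_mul_norm (volume : Measure (EuclideanSpace ℝ (Fin N)))
    (sub_pos.2 h₁)
  refine ⟨∫ x : EuclideanSpace ℝ (Fin N), Real.exp (-(μ₁ - μbar) * ‖x‖),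
    integral_exp_pos hint, fun x₁ x₂ ↦ ?_⟩
  rw [← integral_sub_right_eq_self
    (fun x : EuclideanSpace ℝ (Fin N) ↦ Real.exp (-(μ₁ - μbar) * ‖x‖)) x₁, ← integral_mul_const]
  refine integral_mono_of_nonneg (.of_forall fun x ↦ by positivity)
    ((hint.comp_sub_right x₁).mul_const _) (.of_forall fun x ↦ ?_)
  simp only [← Real.exp_add, ← dist_eq_norm]
  refine Real.exp_le_exp.2 ?_
  have htri := mul_le_mul_of_nonneg_left (dist_triangle_left x₁ x₂ x) hμbar
  have hx₂ := mul_le_mul_of_nonneg_right h₂.le (dist_nonneg (x := x) (y := x₂))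
  linarith
end

section
/- Assume f : ℝ → ℝ is continuously differentiable on ℝ and three times continuously differentiable on ℝ∖{0}, and there exist C > 0 and exponents p₁, p₂ with 1 < p₁ ≤ p₂ such that |f^{(k)}(u)| ≤ C(|u|^{p₁−k} + |u|^{p₂−k}) for k = 0,1,2,3 and all u ≠ 0. Set α := min{(p₁+1)/4, 1}; then α ∈ (1/2, 1]. For every C̃₁ ≥ 1 there is a constant C' > 0 such that |f(u+v) − f(u) − f(v)| ≤ C' |uv|^α for all u, v ∈ ℝ with |u| ≤ C̃₁ and |v| ≤ C̃₁. -/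
theorem Continuous.le_of_forall_ne {X : Type*} [TopologicalSpace X] {g h : X → ℝ} (a : X)
    [(nhdsWithin a {a}ᶜ).NeBot] (hg : Continuous g) (hh : Continuous h)
    (hle : ∀ x, x ≠ a → g x ≤ h x) (x : X) : g x ≤ h x := by
  have hs : closure ({a}ᶜ : Set X) ⊆ {x | g x ≤ h x} :=
    closure_minimal (fun y hy => hle y hy) (isClosed_le hg hh)
  rw [(dense_compl_singleton a).closure_eq] at hs
  exact hs (Set.mem_univ x)

theorem Real.rpow_le_rpow_sub_mul_rpow {x M s t : ℝ} (hx : 0 ≤ x) (hxM : x ≤ M) (hs : 0 ≤ s)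
    (hst : s ≤ t) : x ^ t ≤ M ^ (t - s) * x ^ s := by
  calc x ^ t = x ^ (t - s) * x ^ s := by
        rw [← Real.rpow_add_of_nonneg hx (sub_nonneg.2 hst) hs, sub_add_cancel]
    _ ≤ M ^ (t - s) * x ^ s := by
        gcongr

theorem Real.mul_rpow_two_mul_sub_one_le {x y α : ℝ} (hy : 0 ≤ y) (hyx : y ≤ x)
    (hα : 1 / 2 ≤ α) (hα1 : α ≤ 1) : y * x ^ (2 * α - 1) ≤ (x * y) ^ α := by
  have hx : 0 ≤ x := hy.trans hyx
  calc y * x ^ (2 * α - 1) = y ^ (1 - α) * y ^ α * x ^ (2 * α - 1) := by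
        rw [← Real.rpow_add_of_nonneg hy (by linarith) (by linarith)]
        simp
    _ ≤ x ^ (1 - α) * y ^ α * x ^ (2 * α - 1) := by
        gcongr
    _ = x ^ (1 - α) * x ^ (2 * α - 1) * y ^ α := by ring
    _ = (x * y) ^ α := by
        rw [← Real.rpow_add_of_nonneg hx (by linarith) (by linarith), Real.mul_rpow hx hy]
        ring_nf

/-- A differentiable function vanishing at the origin whose derivative is `O(|w| ^ (2 * α - 1))`
is additive up to an error `O(|u * v| ^ α)`. -/
theorem abs_add_sub_sub_le_of_abs_deriv_le {f : ℝ → ℝ} {K M α : ℝ} (hf : Differentiable ℝ f)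
    (hf0 : f 0 = 0) (hK : 0 ≤ K) (hα : 1 / 2 ≤ α) (hα1 : α ≤ 1)
    (hderiv : ∀ w, |w| ≤ 2 * M → |deriv f w| ≤ K * |w| ^ (2 * α - 1))
    {u v : ℝ} (hu : |u| ≤ M) (hvu : |v| ≤ |u|) :
    |f (u + v) - f u - f v| ≤ 4 * K * |u * v| ^ α := by
  have hbd : ∀ w ∈ Set.Icc (-(2 * |u|)) (2 * |u|), ‖deriv f w‖ ≤ K * (2 * |u|) ^ (2 * α - 1) := by
    intro w hw
    have hw' : |w| ≤ 2 * |u| := abs_le.2 hw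
    refine (hderiv w (by linarith)).trans ?_
    gcongr
    linarith
  have hmem : ∀ w : ℝ, |w| ≤ 2 * |u| → w ∈ Set.Icc (-(2 * |u|)) (2 * |u|) := fun w hw => abs_le.1 hw
  have hu0 := abs_nonneg u
  have h₁ := (convex_Icc _ _).norm_image_sub_le_of_norm_deriv_le (fun w _ => hf w) hbd
    (hmem u (by linarith)) (hmem (u + v) ((abs_add_le u v).trans (by linarith)))
  have h₂ := (convex_Icc _ _).norm_image_sub_le_of_norm_deriv_le (fun w _ => hf w) hbd
    (hmem 0 (by simp)) (hmem v (by linarith))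
  simp only [hf0, sub_zero, add_sub_cancel_left, Real.norm_eq_abs] at h₁ h₂
  have htwo : (2 : ℝ) ^ (2 * α - 1) ≤ 2 := by
    simpa using Real.rpow_le_rpow_of_exponent_le one_le_two (by linarith : 2 * α - 1 ≤ 1)
  calc |f (u + v) - f u - f v| ≤ |f (u + v) - f u| + |f v| := abs_sub _ _
    _ ≤ 2 * K * 2 ^ (2 * α - 1) * (|v| * |u| ^ (2 * α - 1)) := by
        rw [Real.mul_rpow zero_le_two hu0] at h₁ h₂
        linarith
    _ ≤ 2 * K * 2 * |u * v| ^ α := by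
        rw [abs_mul]
        gcongr
        exact Real.mul_rpow_two_mul_sub_one_le (abs_nonneg v) hvu hα hα1
    _ = 4 * K * |u * v| ^ α := by ring

theorem stmt_2 (f : ℝ → ℝ) (C p₁ p₂ : ℝ) (hC : 0 < C) (hp₁ : 1 < p₁) (hp₁₂ : p₁ ≤ p₂)
    (hf1 : ContDiff ℝ 1 f) (hf3 : ContDiffOn ℝ 3 f {(0 : ℝ)}ᶜ)
    (hbound : ∀ k : ℕ, k ≤ 3 → ∀ u : ℝ, u ≠ 0 →
      |iteratedDeriv k f u| ≤ C * (|u| ^ (p₁ - (k : ℝ)) + |u| ^ (p₂ - (k : ℝ)))) :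
    (1 / 2 < min ((p₁ + 1) / 4) 1 ∧ min ((p₁ + 1) / 4) 1 ≤ 1) ∧
    ∀ C₁ : ℝ, 1 ≤ C₁ → ∃ C' > (0 : ℝ), ∀ u v : ℝ, |u| ≤ C₁ → |v| ≤ C₁ →
      |f (u + v) - f u - f v| ≤ C' * |u * v| ^ (min ((p₁ + 1) / 4) 1) := by
  have hα : 1 / 2 < min ((p₁ + 1) / 4) 1 := lt_min (by linarith) (by norm_num)
  have hα1 : min ((p₁ + 1) / 4) 1 ≤ 1 := min_le_right _ _
  have hαp : min ((p₁ + 1) / 4) 1 ≤ (p₁ + 1) / 4 := min_le_left _ _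
  refine ⟨⟨hα, hα1⟩, fun M hM => ?_⟩
  generalize min ((p₁ + 1) / 4) 1 = α at *
  have hcont : ∀ p : ℝ, 0 ≤ p → Continuous fun w : ℝ => |w| ^ p := fun p hp =>
    (Real.continuous_rpow_const hp).comp continuous_abs
  have hf0 : f 0 = 0 := by
    have h := Continuous.le_of_forall_ne (0 : ℝ) hf1.continuous.abs
      (((hcont p₁ (by linarith)).add (hcont p₂ (by linarith))).const_mul C)
      (fun w hw => by simpa using hbound 0 (by norm_num) w hw) 0
    simpa [Real.zero_rpow (by linarith : p₁ ≠ 0), Real.zero_rpow (by linarith : p₂ ≠ 0)] using h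
  have hf' : ∀ w, |deriv f w| ≤ C * (|w| ^ (p₁ - 1) + |w| ^ (p₂ - 1)) :=
    Continuous.le_of_forall_ne 0 (hf1.continuous_deriv le_rfl).abs
      (((hcont _ (by linarith)).add (hcont _ (by linarith))).const_mul C)
      (fun w hw => by simpa using hbound 1 (by norm_num) w hw)
  set K := C * ((2 * M) ^ (p₁ - 1 - (2 * α - 1)) + (2 * M) ^ (p₂ - 1 - (2 * α - 1))) with hKdef
  have hK : 0 < K := by positivity
  have hderiv : ∀ w, |w| ≤ 2 * M → |deriv f w| ≤ K * |w| ^ (2 * α - 1) := by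
    intro w hw
    rw [hKdef, mul_assoc, add_mul]
    refine (hf' w).trans ?_
    gcongr <;> exact Real.rpow_le_rpow_sub_mul_rpow (abs_nonneg w) hw (by linarith) (by linarith)
  have hf : Differentiable ℝ f := hf1.differentiable one_ne_zero
  refine ⟨4 * K, by positivity, fun u v hu hv => ?_⟩
  rcases le_total |v| |u| with h | h
  · exact abs_add_sub_sub_le_of_abs_deriv_le hf hf0 hK.le hα.le hα1 hderiv hu h
  · rw [add_comm, sub_right_comm, mul_comm u]
    exact abs_add_sub_sub_le_of_abs_deriv_le hf hf0 hK.le hα.le hα1 hderiv hv h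
end

section
/- Assume f : ℝ → ℝ is continuously differentiable on ℝ and three times continuously differentiable on ℝ∖{0}, and there exist C > 0 and exponents p₁, p₂ with 1 < p₁ ≤ p₂ such that |f^{(k)}(u)| ≤ C(|u|^{p₁−k} + |u|^{p₂−k}) for k = 0,1,2,3 and all u ≠ 0. Set α := min{(p₁+1)/4, 1} and F(u) := ∫₀^u f(s) ds. For every C̃₁ ≥ 1 there is a constant C' > 0 such that |F(u+v) − F(u) − F(v) − f(u)v − f(v)u| ≤ C' |uv|^{2α} for all u, v ∈ ℝ with |u| ≤ C̃₁ and |v| ≤ C̃₁. -/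
lemma abs_le_of_abs_le_of_ne_zero {g h : ℝ → ℝ} (hg : Continuous g) (hh : Continuous h)
    (hgh : ∀ u, u ≠ 0 → |g u| ≤ h u) (u : ℝ) : |g u| ≤ h u := by
  have hcl : IsClosed {u | |g u| ≤ h u} := isClosed_le hg.abs hh
  have hsub : ({0}ᶜ : Set ℝ) ⊆ {u | |g u| ≤ h u} := fun u hu => hgh u hu
  exact closure_minimal hsub hcl ((dense_compl_singleton (0 : ℝ)) u)

lemma abs_sub_le_of_abs_deriv_le {f : ℝ → ℝ} (hf : Differentiable ℝ f) {L r : ℝ}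
    (hL : ∀ x, |x| ≤ r → |deriv f x| ≤ L) {x y : ℝ} (hx : |x| ≤ r) (hy : |y| ≤ r) :
    |f y - f x| ≤ L * |y - x| := by
  have := (convex_Icc (-r) r).norm_image_sub_le_of_norm_deriv_le (f := f) (C := L) (x := x) (y := y)
    (fun z _ => hf z) (fun z hz => hL z (abs_le.2 hz)) (abs_le.1 hx) (abs_le.1 hy)
  simpa using this

lemma rpow_mul_rpow_le_mul_rpow {a b t x y : ℝ} (hb : 0 < b) (hba : b ≤ a) (hx : t ≤ x)
    (hxy : x + y = 2 * t) : b ^ x * a ^ y ≤ (a * b) ^ t := by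
  have ha : 0 < a := hb.trans_le hba
  calc b ^ x * a ^ y = b ^ t * (b ^ (x - t) * a ^ y) := by
        rw [← mul_assoc, ← Real.rpow_add hb]; ring_nf
    _ ≤ b ^ t * (a ^ (x - t) * a ^ y) := by
        have := Real.rpow_le_rpow hb.le hba (sub_nonneg.2 hx)
        gcongr
    _ = (a * b) ^ t := by
        rw [← Real.rpow_add ha, Real.mul_rpow ha.le hb.le, mul_comm]
        congr 2; linarith

lemma rpow_le_rpow_mul_rpow_sub {x M s t : ℝ} (hx : 0 ≤ x) (hxM : x ≤ M) (ht : 0 ≤ t)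
    (hts : t ≤ s) : x ^ s ≤ x ^ t * M ^ (s - t) := by
  calc x ^ s = x ^ t * x ^ (s - t) := by
        rw [← Real.rpow_add_of_nonneg hx ht (sub_nonneg.2 hts)]; ring_nf
    _ ≤ _ := by
        have := Real.rpow_le_rpow hx hxM (sub_nonneg.2 hts)
        gcongr

lemma abs_primitive_sub_sub_le {f F : ℝ → ℝ} (hf : Differentiable ℝ f)
    (hF : ∀ u : ℝ, F u = ∫ s in (0 : ℝ)..u, f s) {L r : ℝ} (hL0 : 0 ≤ L)
    (hL : ∀ x, |x| ≤ r → |deriv f x| ≤ L) {u v : ℝ} (hu : |u| ≤ r) (huv : |u + v| ≤ r) :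
    |F (u + v) - F u - f u * v| ≤ L * |v| ^ 2 := by
  have hi : ∀ a b : ℝ, IntervalIntegrable f MeasureTheory.volume a b := fun a b =>
    hf.continuous.intervalIntegrable a b
  have heq : F (u + v) - F u - f u * v = ∫ s in u..(u + v), (f s - f u) := by
    rw [intervalIntegral.integral_sub (hi _ _) (by simp), hF, hF,
      intervalIntegral.integral_interval_sub_left (hi _ _) (hi _ _)]
    simp [mul_comm]
  rw [heq]
  have := intervalIntegral.norm_integral_le_of_norm_le_const (a := u) (b := u + v)
    (f := fun s => f s - f u) (C := L * |v|) (fun s hs => by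
      have hs' := Set.uIoc_subset_uIcc hs
      have hsr : |s| ≤ r := abs_le.2 (Set.uIcc_subset_Icc (abs_le.1 hu) (abs_le.1 huv) hs')
      have hsv : |s - u| ≤ |v| := by simpa using Set.abs_sub_left_of_mem_uIcc hs'
      exact (abs_sub_le_of_abs_deriv_le hf hL hu hsr).trans (by gcongr))
  rw [Real.norm_eq_abs, add_sub_cancel_left] at this
  linarith [this, sq |v|]

lemma abs_primitive_defect_le {f F : ℝ → ℝ} (hf : Differentiable ℝ f) (hf0 : f 0 = 0)
    (hF : ∀ u : ℝ, F u = ∫ s in (0 : ℝ)..u, f s) {K M q : ℝ} (hK : 0 ≤ K) (hq1 : 1 < q)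
    (hq3 : q ≤ 3) (hd : ∀ x, |x| ≤ 2 * M → |deriv f x| ≤ K * |x| ^ (q - 1))
    {u v : ℝ} (hu : |u| ≤ M) (hvu : |v| ≤ |u|) :
    |F (u + v) - F u - F v - f u * v - f v * u|
      ≤ K * (2 ^ (q - 1) + 2) * |u * v| ^ ((q + 1) / 2) := by
  have hF0 : F 0 = 0 := by simp [hF]
  rcases eq_or_ne v 0 with rfl | hv
  · simp only [add_zero, hF0, hf0, mul_zero, zero_mul, sub_self, abs_zero]
    positivity
  have hb : 0 < |v| := abs_pos.2 hv
  have hL : ∀ r, r ≤ 2 * M → ∀ x, |x| ≤ r → |deriv f x| ≤ K * r ^ (q - 1) := by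
    intro r hr x hx
    refine (hd x (hx.trans hr)).trans ?_
    have := Real.rpow_le_rpow (abs_nonneg x) hx (by linarith : 0 ≤ q - 1)
    gcongr
  have hu0 := abs_nonneg u
  have h1 := abs_primitive_sub_sub_le (u := u) (v := v) hf hF (by positivity)
    (hL (2 * |u|) (by linarith)) (by linarith) ((abs_add_le u v).trans (by linarith))
  have h2 := abs_primitive_sub_sub_le (u := 0) (v := v) hf hF (by positivity)
    (hL |v| (by linarith)) (by simp) (by simp)
  have h3 := abs_sub_le_of_abs_deriv_le (x := 0) (y := v) hf
    (hL |v| (by linarith)) (by simp) le_rfl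
  simp only [zero_add, hF0, hf0, sub_zero, zero_mul] at h2 h3
  have e1 : |v| ^ (2 : ℝ) * |u| ^ (q - 1) ≤ (|u| * |v|) ^ ((q + 1) / 2) :=
    rpow_mul_rpow_le_mul_rpow hb hvu (by linarith) (by ring)
  have e2 : |v| ^ (q + 1) * |u| ^ (0 : ℝ) ≤ (|u| * |v|) ^ ((q + 1) / 2) :=
    rpow_mul_rpow_le_mul_rpow hb hvu (by linarith) (by ring)
  have e3 : |v| ^ q * |u| ^ (1 : ℝ) ≤ (|u| * |v|) ^ ((q + 1) / 2) :=
    rpow_mul_rpow_le_mul_rpow hb hvu (by linarith) (by ring)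
  have r1 : |v| ^ (q + 1) = |v| ^ (q - 1) * |v| ^ 2 := by
    rw [← Real.rpow_natCast, ← Real.rpow_add hb]; norm_num; ring_nf
  have r2 : |v| ^ q = |v| ^ (q - 1) * |v| := by
    rw [← Real.rpow_add_one hb.ne']; ring_nf
  rw [Real.rpow_two] at e1
  rw [r1, Real.rpow_zero, mul_one] at e2
  rw [r2, Real.rpow_one] at e3
  rw [Real.mul_rpow zero_le_two hu0] at h1
  rw [abs_mul]
  have t1 : |F (u + v) - F u - F v - f u * v - f v * u|
      ≤ |F (u + v) - F u - f u * v| + |F v| + |f v| * |u| := by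
    rw [← abs_mul]
    calc _ = |(F (u + v) - F u - f u * v) - F v - f v * u| := by ring_nf
      _ ≤ _ := (abs_sub _ _).trans (by gcongr; exact abs_sub _ _)
  have g3 := mul_le_mul_of_nonneg_right h3 hu0
  have k1 := mul_le_mul_of_nonneg_left e1 (by positivity : 0 ≤ K * 2 ^ (q - 1))
  have k2 := mul_le_mul_of_nonneg_left e2 hK
  have k3 := mul_le_mul_of_nonneg_left e3 hK
  linarith


theorem stmt_3 (f : ℝ → ℝ) (C p₁ p₂ : ℝ) (hC : 0 < C) (hp₁ : 1 < p₁) (hp₁₂ : p₁ ≤ p₂)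
    (hf1 : ContDiff ℝ 1 f) (hf3 : ContDiffOn ℝ 3 f {(0 : ℝ)}ᶜ)
    (hbound : ∀ k : ℕ, k ≤ 3 → ∀ u : ℝ, u ≠ 0 →
      |iteratedDeriv k f u| ≤ C * (|u| ^ (p₁ - (k : ℝ)) + |u| ^ (p₂ - (k : ℝ))))
    (F : ℝ → ℝ) (hF : ∀ u : ℝ, F u = ∫ s in (0 : ℝ)..u, f s) :
    ∀ C₁ : ℝ, 1 ≤ C₁ → ∃ C' > (0 : ℝ), ∀ u v : ℝ, |u| ≤ C₁ → |v| ≤ C₁ →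
      |F (u + v) - F u - F v - f u * v - f v * u|
        ≤ C' * |u * v| ^ (2 * min ((p₁ + 1) / 4) 1) := by
  intro C₁ hC₁
  set q := min p₁ 3 with hq
  have hqp : q ≤ p₁ := min_le_left _ _
  have hq1 : 1 < q := lt_min hp₁ (by norm_num)
  have hexp : 2 * min ((p₁ + 1) / 4) 1 = (q + 1) / 2 := by
    rcases le_total p₁ 3 with h | h
    · rw [hq, min_eq_left h, min_eq_left (by linarith)]; ring
    · rw [hq, min_eq_right h, min_eq_right (by linarith)]; ring
  have hf : Differentiable ℝ f := hf1.differentiable (by norm_num)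
  have hf0 : f 0 = 0 := by
    have := abs_le_of_abs_le_of_ne_zero (h := fun u => C * (|u| ^ p₁ + |u| ^ p₂)) hf.continuous
      (continuous_const.mul ((continuous_abs.rpow_const fun _ => Or.inr (by linarith)).add
        (continuous_abs.rpow_const fun _ => Or.inr (by linarith))))
      (fun u hu => by simpa using hbound 0 (by norm_num) u hu) 0
    simpa [Real.zero_rpow (by linarith : p₁ ≠ 0), Real.zero_rpow (by linarith : p₂ ≠ 0)] using this
  have hd := abs_le_of_abs_le_of_ne_zero
      (h := fun u => C * (|u| ^ (p₁ - 1) + |u| ^ (p₂ - 1))) (hf1.continuous_deriv le_rfl)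
      (continuous_const.mul ((continuous_abs.rpow_const fun _ => Or.inr (by linarith)).add
        (continuous_abs.rpow_const fun _ => Or.inr (by linarith))))
      (fun u hu => by simpa using hbound 1 (by norm_num) u hu)
  set K := C * ((2 * C₁) ^ (p₁ - 1 - (q - 1)) + (2 * C₁) ^ (p₂ - 1 - (q - 1))) with hK
  have hK0 : 0 < K := by positivity
  have hdK : ∀ x, |x| ≤ 2 * C₁ → |deriv f x| ≤ K * |x| ^ (q - 1) := by
    intro x hx
    have h1 := rpow_le_rpow_mul_rpow_sub (abs_nonneg x) hx (by linarith : 0 ≤ q - 1)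
      (by linarith : q - 1 ≤ p₁ - 1)
    have h2 := rpow_le_rpow_mul_rpow_sub (abs_nonneg x) hx (by linarith : 0 ≤ q - 1)
      (by linarith : q - 1 ≤ p₂ - 1)
    calc |deriv f x| ≤ C * (|x| ^ (p₁ - 1) + |x| ^ (p₂ - 1)) := hd x
      _ ≤ C * (|x| ^ (q - 1) * (2 * C₁) ^ (p₁ - 1 - (q - 1))
          + |x| ^ (q - 1) * (2 * C₁) ^ (p₂ - 1 - (q - 1))) := by gcongr
      _ = K * |x| ^ (q - 1) := by rw [hK]; ring
  refine ⟨K * (2 ^ (q - 1) + 2), by positivity, fun u v hu hv => ?_⟩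
  rw [hexp]
  rcases le_total |v| |u| with h | h
  · exact abs_primitive_defect_le hf hf0 hF hK0.le hq1 (min_le_right _ _) hdK hu h
  · have := abs_primitive_defect_le hf hf0 hF hK0.le hq1 (min_le_right _ _) hdK hv h
    rw [add_comm v u, mul_comm v u] at this
    convert this using 2
    ring
end

section
/- Assume f : ℝ → ℝ is continuously differentiable on ℝ and three times continuously differentiable on ℝ∖{0}, and there exist C > 0 and exponents p₁, p₂ with 1 < p₁ ≤ p₂ such that |f^{(k)}(u)| ≤ C(|u|^{p₁−k} + |u|^{p₂−k}) for k = 0,1,2,3 and all u ≠ 0. Set α := min{(p₁+1)/4, 1}; then α ∈ (1/2, 1] and the following holds: for every C̃₁ ≥ 1 and every n ∈ ℕ there is a constant C̃₂ > 0 such that for all u₁, …, u_n ∈ ℝ with |u_i| ≤ C̃₁ for every i, one has |f(∑_{i=1}^n u_i) − ∑_{i=1}^n f(u_i)| ≤ C̃₂ · ∑_{1 ≤ i < j ≤ n} |u_i u_j|^α. -/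
open Finset in
/-- A function which is additive up to `K * |a * b| ^ α` on `[-R, R]` is additive over finite sums
up to the corresponding sum over pairs. -/
theorem abs_map_sum_sub_sum_le {f : ℝ → ℝ} {α K R : ℝ} (hα₀ : 0 < α) (hα₁ : α ≤ 1) (hK : 0 ≤ K)
    (hf : ∀ a b, |a| ≤ R → |b| ≤ R → |f (a + b) - f a - f b| ≤ K * |a * b| ^ α) :
    ∀ (n : ℕ) (u : Fin n → ℝ), ∑ i, |u i| ≤ R →
      |f (∑ i, u i) - ∑ i, f (u i)|
        ≤ K * ∑ i : Fin n, ∑ j : Fin n, if i < j then |u i * u j| ^ α else 0 := by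
  intro n
  induction n with
  | zero =>
    intro u hu
    have hR : 0 ≤ R := by simpa using hu
    simpa [Real.zero_rpow hα₀.ne'] using hf 0 0 (by simpa) (by simpa)
  | succ n ih =>
    intro u hu
    rw [Fin.sum_univ_castSucc] at hu
    set S := ∑ i : Fin n, u i.castSucc with hS
    have hSle : |S| ≤ ∑ i : Fin n, |u i.castSucc| := abs_sum_le_sum_abs _ _
    have hsum₀ : 0 ≤ ∑ i : Fin n, |u i.castSucc| := sum_nonneg fun i _ => abs_nonneg _
    have hlast₀ := abs_nonneg (u (Fin.last n))
    have hstep := hf S (u (Fin.last n)) (by linarith) (by linarith)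
    have hrec := ih (fun i => u i.castSucc) (by linarith)
    have hpow : |S| ^ α ≤ ∑ i : Fin n, |u i.castSucc| ^ α :=
      le_sum_of_subadditive (fun x : ℝ => |x| ^ α) (by simp [Real.zero_rpow hα₀.ne'])
        (fun x y => (Real.rpow_le_rpow (abs_nonneg _) (abs_add_le x y) hα₀.le).trans
          (Real.rpow_add_le_add_rpow (abs_nonneg _) (abs_nonneg _) hα₀.le hα₁)) _ _
    have hcross : |S * u (Fin.last n)| ^ α ≤ ∑ i : Fin n, |u i.castSucc * u (Fin.last n)| ^ α := by
      simp only [abs_mul, Real.mul_rpow (abs_nonneg _) (abs_nonneg _), ← sum_mul]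
      gcongr
    have hpairs : (∑ i : Fin (n + 1), ∑ j : Fin (n + 1), if i < j then |u i * u j| ^ α else 0)
        = (∑ i : Fin n, ∑ j : Fin n, if i < j then |u i.castSucc * u j.castSucc| ^ α else 0)
          + ∑ i : Fin n, |u i.castSucc * u (Fin.last n)| ^ α := by
      simp [Fin.sum_univ_castSucc, sum_add_distrib, Fin.castSucc_lt_last,
        not_lt.mpr (Fin.le_last _)]
    rw [hpairs, Fin.sum_univ_castSucc, Fin.sum_univ_castSucc, ← hS]
    calc |f (S + u (Fin.last n)) - (∑ i : Fin n, f (u i.castSucc) + f (u (Fin.last n)))|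
        = |(f S - ∑ i : Fin n, f (u i.castSucc))
            + (f (S + u (Fin.last n)) - f S - f (u (Fin.last n)))| := by congr 1; ring
      _ ≤ _ := abs_add_le _ _
      _ ≤ _ := add_le_add hrec (hstep.trans (mul_le_mul_of_nonneg_left hcross hK))
      _ = _ := by rw [mul_add]

/-- If `f 0 = 0` and `|f' t| ≤ M * |t| ^ (p - 1)` near the origin, then `f` is additive up to a
multiple of `|a * b| ^ α` for every `α ≤ 1` with `2 * α ≤ p`. -/
theorem abs_map_add_sub_le {f : ℝ → ℝ} {α p M R : ℝ} (hα₀ : 0 < α) (hα₁ : α ≤ 1)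
    (hαp : 2 * α ≤ p) (hp : 1 ≤ p) (hM : 0 ≤ M) (hf : Differentiable ℝ f) (hf₀ : f 0 = 0)
    (hf' : ∀ t, |t| ≤ 2 * R → |deriv f t| ≤ M * |t| ^ (p - 1)) (a b : ℝ)
    (ha : |a| ≤ R) (hb : |b| ≤ R) :
    |f (a + b) - f a - f b| ≤ 2 * M * 2 ^ (p - 1) * R ^ (p - 2 * α) * |a * b| ^ α := by
  wlog hab : |b| ≤ |a| generalizing a b
  · have h := this b a hb ha (le_of_not_ge hab)
    rwa [add_comm b a, mul_comm b a, sub_right_comm] at h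
  rcases eq_or_ne b 0 with rfl | hb₀
  · simp [hf₀, Real.zero_rpow hα₀.ne']
  have hb_pos : 0 < |b| := abs_pos.mpr hb₀
  have ha_pos : 0 < |a| := hb_pos.trans_le hab
  have hlip : ∀ x y, |x| ≤ 2 * |a| → |y| ≤ 2 * |a| →
      |f y - f x| ≤ M * (2 * |a|) ^ (p - 1) * |y - x| := by
    intro x y hx hy
    refine Convex.norm_image_sub_le_of_norm_deriv_le (s := Set.Icc (-(2 * |a|)) (2 * |a|))
      (fun t _ => hf t) (fun t ht => ?_) (convex_Icc _ _) (abs_le.mp hx) (abs_le.mp hy)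
    have ht' : |t| ≤ 2 * |a| := abs_le.mpr ht
    refine (hf' t (by linarith)).trans ?_
    have : 0 ≤ p - 1 := by linarith
    gcongr
  have h₁ := hlip a (a + b) (by linarith) ((abs_add_le a b).trans (by linarith))
  have h₂ := hlip 0 b (by simp) (by linarith)
  rw [add_sub_cancel_left] at h₁
  rw [hf₀, sub_zero, sub_zero] at h₂
  have hprod : |a| ^ (p - 1) * |b| ≤ R ^ (p - 2 * α) * |a * b| ^ α :=
    calc |a| ^ (p - 1) * |b| = |a| ^ (p - 1) * (|b| ^ (1 - α) * |b| ^ α) := by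
          rw [← Real.rpow_add hb_pos, sub_add_cancel, Real.rpow_one]
      _ ≤ |a| ^ (p - 1) * (|a| ^ (1 - α) * |b| ^ α) := by
          have : 0 ≤ 1 - α := by linarith
          gcongr
      _ = |a| ^ (p - 2 * α) * |a * b| ^ α := by
          rw [abs_mul, Real.mul_rpow ha_pos.le hb_pos.le, ← mul_assoc, ← mul_assoc,
            ← Real.rpow_add ha_pos, ← Real.rpow_add ha_pos]
          ring_nf
      _ ≤ R ^ (p - 2 * α) * |a * b| ^ α := by
          have : 0 ≤ p - 2 * α := by linarith
          gcongr
  calc |f (a + b) - f a - f b| ≤ |f (a + b) - f a| + |f b| := abs_sub _ _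
    _ ≤ 2 * M * 2 ^ (p - 1) * (|a| ^ (p - 1) * |b|) := by
        rw [Real.mul_rpow zero_le_two ha_pos.le] at h₁ h₂
        linarith
    _ ≤ 2 * M * 2 ^ (p - 1) * (R ^ (p - 2 * α) * |a * b| ^ α) := by gcongr
    _ = _ := by ring

/-- A bound between continuous functions away from a point extends to that point. -/
theorem le_of_forall_ne_le {g h : ℝ → ℝ} {x₀ : ℝ} (hg : Continuous g) (hh : Continuous h)
    (hle : ∀ x, x ≠ x₀ → g x ≤ h x) (x : ℝ) : g x ≤ h x := by
  have hsub : closure ({x₀}ᶜ : Set ℝ) ⊆ {x | g x ≤ h x} :=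
    closure_minimal (fun x hx => hle x hx) (isClosed_le hg hh)
  rw [(dense_compl_singleton x₀).closure_eq] at hsub
  exact hsub (Set.mem_univ x)

theorem stmt_4 (f : ℝ → ℝ) (C p₁ p₂ : ℝ) (hC : 0 < C) (hp₁ : 1 < p₁) (hp₁₂ : p₁ ≤ p₂)
    (hf1 : ContDiff ℝ 1 f) (hf3 : ContDiffOn ℝ 3 f {(0 : ℝ)}ᶜ)
    (hbound : ∀ k : ℕ, k ≤ 3 → ∀ u : ℝ, u ≠ 0 →
      |iteratedDeriv k f u| ≤ C * (|u| ^ (p₁ - (k : ℝ)) + |u| ^ (p₂ - (k : ℝ)))) :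
    (1 / 2 < min ((p₁ + 1) / 4) 1 ∧ min ((p₁ + 1) / 4) 1 ≤ 1) ∧
    ∀ C₁ : ℝ, 1 ≤ C₁ → ∀ n : ℕ, ∃ C₂ > (0 : ℝ), ∀ u : Fin n → ℝ,
      (∀ i, |u i| ≤ C₁) →
      |f (∑ i, u i) - ∑ i, f (u i)|
        ≤ C₂ * ∑ i : Fin n, ∑ j : Fin n,
            (if i < j then |u i * u j| ^ (min ((p₁ + 1) / 4) 1) else 0) := by
  set α := min ((p₁ + 1) / 4) 1
  have hα : 1 / 2 < α := lt_min (by linarith) (by norm_num)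
  have hα₁ : α ≤ 1 := min_le_right _ _
  have hαp : 2 * α ≤ p₁ := by linarith [min_le_left ((p₁ + 1) / 4) 1]
  refine ⟨⟨hα, hα₁⟩, fun C₁ hC₁ n => ?_⟩
  have hpow : ∀ q₁ q₂ : ℝ, 0 ≤ q₁ → 0 ≤ q₂ →
      Continuous fun u : ℝ => C * (|u| ^ q₁ + |u| ^ q₂) := fun q₁ q₂ h₁ h₂ =>
    continuous_const.mul ((continuous_abs.rpow_const fun _ => Or.inr h₁).add
      (continuous_abs.rpow_const fun _ => Or.inr h₂))
  have hf₀ : f 0 = 0 := by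
    have h := le_of_forall_ne_le (x₀ := 0) hf1.continuous.abs
      (hpow p₁ p₂ (by linarith) (by linarith))
      (fun u hu => by simpa using hbound 0 (by norm_num) u hu) 0
    simpa [Real.zero_rpow (show p₁ ≠ 0 by linarith), Real.zero_rpow (show p₂ ≠ 0 by linarith)]
      using h
  have hf' : ∀ u, |deriv f u| ≤ C * (|u| ^ (p₁ - 1) + |u| ^ (p₂ - 1)) :=
    le_of_forall_ne_le (x₀ := 0) (hf1.continuous_deriv le_rfl).abs
      (hpow (p₁ - 1) (p₂ - 1) (by linarith) (by linarith))
      (fun u hu => by simpa [iteratedDeriv_one] using hbound 1 (by norm_num) u hu)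
  set R := (n + 1) * C₁
  have hR : 0 < R := by positivity
  set M := C * (1 + (2 * R) ^ (p₂ - p₁))
  have hM : 0 < M := by positivity
  have hf'M : ∀ t, |t| ≤ 2 * R → |deriv f t| ≤ M * |t| ^ (p₁ - 1) := by
    intro t ht
    have hsplit : |t| ^ (p₂ - 1) ≤ (2 * R) ^ (p₂ - p₁) * |t| ^ (p₁ - 1) := by
      rw [show p₂ - 1 = (p₂ - p₁) + (p₁ - 1) by ring,
        Real.rpow_add_of_nonneg (abs_nonneg t) (by linarith) (by linarith)]
      have : 0 ≤ p₂ - p₁ := by linarith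
      gcongr
    calc |deriv f t| ≤ C * (|t| ^ (p₁ - 1) + |t| ^ (p₂ - 1)) := hf' t
      _ ≤ C * (|t| ^ (p₁ - 1) + (2 * R) ^ (p₂ - p₁) * |t| ^ (p₁ - 1)) := by gcongr
      _ = M * |t| ^ (p₁ - 1) := by ring
  refine ⟨2 * M * 2 ^ (p₁ - 1) * R ^ (p₁ - 2 * α), by positivity, fun u hu =>
    abs_map_sum_sub_sum_le (R := R) (by linarith) hα₁ (by positivity)
      (abs_map_add_sub_le (by linarith) hα₁ hαp hp₁.le hM.le
        (hf1.differentiable one_ne_zero) hf₀ hf'M) n u ?_⟩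
  calc ∑ i, |u i| ≤ ∑ _i : Fin n, C₁ := Finset.sum_le_sum fun i _ => hu i
    _ = n * C₁ := by simp
    _ ≤ (n + 1) * C₁ := by linarith
end

section
/- Let x₁, x₂, x₃ ∈ ℝ^N be three pairwise distinct points and let w ≤ v ≤ u be the side lengths |x_i − x_j| (i < j) of the triangle they form, listed in increasing order. If one of the interior angles of the triangle is greater than or equal to 2π/3, then inf_{x ∈ ℝ^N} (|x−x₁| + |x−x₂| + |x−x₃|) = v + w, i.e. the minimal total distance to the three vertices equals the sum of the two smallest side lengths. -/
open EuclideanGeometry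

section ObtuseVectors

variable {V : Type*} [NormedAddCommGroup V] [InnerProductSpace ℝ V]

lemma cos_le_neg_half_of_two_pi_div_three_le {θ : ℝ} (h : 2 * Real.pi / 3 ≤ θ)
    (hθ : θ ≤ Real.pi) : Real.cos θ ≤ -(1 / 2) := by
  have hcos : Real.cos (2 * Real.pi / 3) = -(1 / 2) := by
    rw [show 2 * Real.pi / 3 = Real.pi - Real.pi / 3 by ring, Real.cos_pi_sub,
      Real.cos_pi_div_three]
  rw [← hcos]
  exact Real.cos_le_cos_of_nonneg_of_le_pi (by positivity) hθ h

lemma norm_le_norm_sub_of_two_pi_div_three_le_angle {a b : V}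
    (h : 2 * Real.pi / 3 ≤ InnerProductGeometry.angle a b) : ‖a‖ ≤ ‖a - b‖ := by
  have hcos := cos_le_neg_half_of_two_pi_div_three_le h (InnerProductGeometry.angle_le_pi a b)
  have hinner := InnerProductGeometry.cos_angle_mul_norm_mul_norm a b
  have hsq := norm_sub_sq_real a b
  refine le_of_sq_le_sq ?_ (norm_nonneg _)
  nlinarith [mul_nonneg (norm_nonneg a) (norm_nonneg b), sq_nonneg ‖b‖]

lemma norm_add_le_one_of_inner_le_neg_half {e f : V} (he : ‖e‖ = 1) (hf : ‖f‖ = 1)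
    (h : inner ℝ e f ≤ -(1 / 2)) : ‖e + f‖ ≤ 1 := by
  have hsq := norm_add_sq_real e f
  rw [he, hf] at hsq
  nlinarith [norm_nonneg (e + f)]

lemma norm_sub_inner_le_norm_sub {a : V} (ha : a ≠ 0) (q : V) :
    ‖a‖ - inner ℝ q (‖a‖⁻¹ • a) ≤ ‖q - a‖ := by
  have ha' : ‖a‖ ≠ 0 := norm_ne_zero_iff.mpr ha
  have hunit : ‖‖a‖⁻¹ • a‖ = 1 := norm_smul_inv_norm (𝕜 := ℝ) ha
  have hself : inner ℝ a (‖a‖⁻¹ • a) = ‖a‖ := by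
    rw [inner_smul_right, real_inner_self_eq_norm_sq]
    field_simp
  have hcs := real_inner_le_norm (a - q) (‖a‖⁻¹ • a)
  rw [inner_sub_left, hself, hunit, mul_one, norm_sub_rev] at hcs
  exact hcs

lemma norm_add_norm_le_of_two_pi_div_three_le_angle {a b : V} (ha : a ≠ 0) (hb : b ≠ 0)
    (h : 2 * Real.pi / 3 ≤ InnerProductGeometry.angle a b) (q : V) :
    ‖a‖ + ‖b‖ ≤ ‖q‖ + ‖q - a‖ + ‖q - b‖ := by
  have hinner : inner ℝ (‖a‖⁻¹ • a) (‖b‖⁻¹ • b) = Real.cos (InnerProductGeometry.angle a b) := by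
    rw [inner_smul_left, inner_smul_right, InnerProductGeometry.cos_angle, div_eq_mul_inv, mul_inv]
    simp only [conj_trivial]
    ring
  have hnorm : ‖‖a‖⁻¹ • a + ‖b‖⁻¹ • b‖ ≤ 1 :=
    norm_add_le_one_of_inner_le_neg_half (norm_smul_inv_norm (𝕜 := ℝ) ha)
      (norm_smul_inv_norm (𝕜 := ℝ) hb)
      (hinner ▸ cos_le_neg_half_of_two_pi_div_three_le h (InnerProductGeometry.angle_le_pi a b))
  have hcs := (real_inner_le_norm q (‖a‖⁻¹ • a + ‖b‖⁻¹ • b)).trans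
    (mul_le_of_le_one_right (norm_nonneg q) hnorm)
  rw [inner_add_right] at hcs
  linarith [norm_sub_inner_le_norm_sub ha q, norm_sub_inner_le_norm_sub hb q]

end ObtuseVectors

section ObtuseTriangle

variable {V P : Type*} [NormedAddCommGroup V] [InnerProductSpace ℝ V] [MetricSpace P]
  [NormedAddTorsor V P]

lemma dist_le_dist_of_two_pi_div_three_le_angle {y p z : P}
    (h : 2 * Real.pi / 3 ≤ ∠ y p z) : dist p y ≤ dist y z := by
  rw [dist_comm p y, dist_eq_norm_vsub V y p, dist_eq_norm_vsub V y z,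
    ← vsub_sub_vsub_cancel_right y z p]
  exact norm_le_norm_sub_of_two_pi_div_three_le_angle h

/-- If the angle at `p` is at least `2π/3`, then `p` minimizes the total distance to the
vertices. -/
lemma iInf_dist_add_dist_add_dist_of_two_pi_div_three_le_angle {y p z : P} (hy : y ≠ p)
    (hz : z ≠ p) (h : 2 * Real.pi / 3 ≤ ∠ y p z) :
    (⨅ x : P, (dist x p + dist x y + dist x z)) = dist p y + dist p z := by
  have hleast : IsLeast (Set.range fun x : P => dist x p + dist x y + dist x z)
      (dist p y + dist p z) := by
    refine ⟨⟨p, by simp⟩, ?_⟩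
    rintro _ ⟨x, rfl⟩
    have key := norm_add_norm_le_of_two_pi_div_three_le_angle (vsub_ne_zero.mpr hy)
      (vsub_ne_zero.mpr hz) h (x -ᵥ p)
    rw [vsub_sub_vsub_cancel_right, vsub_sub_vsub_cancel_right] at key
    simpa only [← dist_eq_norm_vsub, dist_comm y p, dist_comm z p] using key
  exact hleast.csInf_eq

end ObtuseTriangle

lemma add_eq_add_of_multiset_eq_of_le {w v u a b c : ℝ} (hwv : w ≤ v) (hvu : v ≤ u)
    (h : ({w, v, u} : Multiset ℝ) = {a, b, c}) (hac : a ≤ c) (hbc : b ≤ c) :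
    a + b = v + w := by
  have hsum := congrArg Multiset.sum h
  simp only [Multiset.insert_eq_cons, Multiset.sum_cons, Multiset.sum_singleton] at hsum
  have hu : u ∈ ({a, b, c} : Multiset ℝ) := h ▸ by simp
  have hc : c ∈ ({w, v, u} : Multiset ℝ) := h ▸ by simp
  simp only [Multiset.insert_eq_cons, Multiset.mem_cons, Multiset.mem_singleton] at hu hc
  have huc : u ≤ c := by rcases hu with rfl | rfl | rfl <;> linarith
  have hcu : c ≤ u := by rcases hc with rfl | rfl | rfl <;> linarith
  linarith

lemma iInf_dist_eq_of_two_pi_div_three_le_angle {V P : Type*} [NormedAddCommGroup V]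
    [InnerProductSpace ℝ V] [MetricSpace P] [NormedAddTorsor V P] {y p z : P} (hy : y ≠ p)
    (hz : z ≠ p) {w v u : ℝ} (hwv : w ≤ v) (hvu : v ≤ u)
    (hsides : ({w, v, u} : Multiset ℝ) = {dist p y, dist p z, dist y z})
    (h : 2 * Real.pi / 3 ≤ ∠ y p z) :
    (⨅ x : P, (dist x p + dist x y + dist x z)) = v + w := by
  rw [iInf_dist_add_dist_add_dist_of_two_pi_div_three_le_angle hy hz h]
  refine add_eq_add_of_multiset_eq_of_le hwv hvu hsides
    (dist_le_dist_of_two_pi_div_three_le_angle h) ?_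
  rw [dist_comm y z]
  exact dist_le_dist_of_two_pi_div_three_le_angle (angle_comm y p z ▸ h)

theorem stmt_6 (N : ℕ) (x₁ x₂ x₃ : EuclideanSpace ℝ (Fin N))
    (h12 : x₁ ≠ x₂) (h13 : x₁ ≠ x₃) (h23 : x₂ ≠ x₃)
    (w v u : ℝ) (hwv : w ≤ v) (hvu : v ≤ u)
    (hsides : ({w, v, u} : Multiset ℝ) = {dist x₁ x₂, dist x₂ x₃, dist x₁ x₃})
    (hangle : 2 * Real.pi / 3 ≤ EuclideanGeometry.angle x₂ x₁ x₃ ∨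
              2 * Real.pi / 3 ≤ EuclideanGeometry.angle x₁ x₂ x₃ ∨
              2 * Real.pi / 3 ≤ EuclideanGeometry.angle x₁ x₃ x₂) :
    (⨅ x : EuclideanSpace ℝ (Fin N), (dist x x₁ + dist x x₂ + dist x x₃)) = v + w := by
  rcases hangle with h | h | h
  · refine iInf_dist_eq_of_two_pi_div_three_le_angle h12.symm h13.symm hwv hvu ?_ h
    rw [hsides]
    simp only [Multiset.insert_eq_cons, ← Multiset.singleton_add]
    abel
  · rw [← iInf_dist_eq_of_two_pi_div_three_le_angle h12 h23.symm hwv hvu ?_ h]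
    · congr! 2 with x
      ring
    · rw [hsides, dist_comm x₂ x₁]
  · rw [← iInf_dist_eq_of_two_pi_div_three_le_angle h13 h23 hwv hvu ?_ h]
    · congr! 2 with x
      ring
    · rw [hsides, dist_comm x₃ x₁, dist_comm x₃ x₂]
      simp only [Multiset.insert_eq_cons, ← Multiset.singleton_add]
      abel
end

section
/- Let n ≥ 1 and let x₁, x₂ ∈ ℝ^n with |x₁−x₂| < 1. Then vol_n(B₁(x₁) ∖ B₁(x₂)) ≤ ω_{n−1} · |x₁−x₂|, where ω_{n−1} denotes the Lebesgue measure of the unit ball in ℝ^{n−1} (with the convention ω₀ = 1). -/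
open MeasureTheory

/-- A line parallel to the direction of translation, at squared distance `q` from the axis, meets
the difference of two translated unit balls in a set of length at most the translation distance. -/
theorem volume_slice_ball_diff_le {d q : ℝ} (hd : 0 ≤ d) :
    volume {t : ℝ | (t - d) ^ 2 + q < 1 ∧ ¬ t ^ 2 + q < 1}
      ≤ (Set.Iio (1 : ℝ)).indicator (fun _ => ENNReal.ofReal d) q := by
  by_cases hq : q < 1
  · rw [Set.indicator_of_mem (Set.mem_Iio.2 hq)]
    have hsub : {t : ℝ | (t - d) ^ 2 + q < 1 ∧ ¬ t ^ 2 + q < 1}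
        ⊆ Set.Icc (√(1 - q)) (√(1 - q) + d) := by
      rintro t ⟨h₁, h₂⟩
      have hs : √(1 - q) ^ 2 = 1 - q := Real.sq_sqrt (by linarith)
      have hs₀ : 0 ≤ √(1 - q) := Real.sqrt_nonneg _
      obtain ⟨h₃, h₄⟩ := abs_lt_of_sq_lt_sq' (show (t - d) ^ 2 < √(1 - q) ^ 2 by linarith) hs₀
      refine ⟨?_, by linarith⟩
      by_contra! h₅
      exact h₂ (by nlinarith)
    refine (measure_mono hsub).trans ?_
    simp
  · have hempty : {t : ℝ | (t - d) ^ 2 + q < 1 ∧ ¬ t ^ 2 + q < 1} = ∅ := by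
      ext t
      simp only [Set.mem_ofPred_eq, Set.mem_empty_iff_false, iff_false, not_and]
      intro h₁
      nlinarith [sq_nonneg (t - d)]
    rw [hempty, measure_empty]
    exact zero_le

theorem EuclideanSpace.volume_ball_diff_ball_single_le (m : ℕ) {d : ℝ} (hd : 0 ≤ d) :
    volume (Metric.ball (EuclideanSpace.single (0 : Fin (m + 1)) d) 1 \ Metric.ball 0 1)
      ≤ volume (Metric.ball (0 : EuclideanSpace ℝ (Fin m)) 1) * ENNReal.ofReal d := by
  have hpres := ((EuclideanSpace.volume_preserving_symm_measurableEquiv_toLp (Fin (m + 1))).symm).comp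
    (volume_preserving_piFinSuccAbove (fun _ : Fin (m + 1) => ℝ) 0).symm
  have hmeas : MeasurableSet
      (Metric.ball (EuclideanSpace.single (0 : Fin (m + 1)) d) 1 \ Metric.ball 0 1) :=
    measurableSet_ball.diff measurableSet_ball
  rw [← hpres.measure_preimage hmeas.nullMeasurableSet, Measure.volume_eq_prod,
    Measure.prod_apply_symm (hpres.measurable hmeas)]
  have hball : MeasurableSet {y : Fin m → ℝ | ∑ i, y i ^ 2 < 1} :=
    measurableSet_lt (by fun_prop) measurable_const
  have hvol : volume (Metric.ball (0 : EuclideanSpace ℝ (Fin m)) 1)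
      = volume {y : Fin m → ℝ | ∑ i, y i ^ 2 < 1} := by
    rw [← (EuclideanSpace.volume_preserving_symm_measurableEquiv_toLp (Fin m)).measure_preimage
      hball.nullMeasurableSet]
    congr 1
    ext y
    simp [EuclideanSpace.norm_eq, Real.sqrt_lt' one_pos]
  calc _ ≤ ∫⁻ y : Fin m → ℝ, {y : Fin m → ℝ | ∑ i, y i ^ 2 < 1}.indicator
          (fun _ => ENNReal.ofReal d) y := by
        refine lintegral_mono fun y => ?_
        refine le_trans (le_of_eq ?_) (volume_slice_ball_diff_le (q := ∑ i, y i ^ 2) hd)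
        congr 1
        ext t
        simp [EuclideanSpace.dist_eq, EuclideanSpace.norm_eq, Real.sqrt_lt' one_pos,
          Fin.sum_univ_succ, Real.dist_eq]
    _ = _ := by rw [lintegral_indicator_const hball, hvol, mul_comm]

theorem stmt_11 (n : ℕ) (hn : 1 ≤ n) (x₁ x₂ : EuclideanSpace ℝ (Fin n))
    (h : dist x₁ x₂ < 1) :
    volume (Metric.ball x₁ 1 \ Metric.ball x₂ 1)
      ≤ volume (Metric.ball (0 : EuclideanSpace ℝ (Fin (n - 1))) 1)
          * ENNReal.ofReal (dist x₁ x₂) := by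
  obtain ⟨m, rfl⟩ : ∃ m, n = m + 1 := ⟨n - 1, by omega⟩
  rcases eq_or_ne x₁ x₂ with rfl | hne
  · simp
  have hnorm : ‖x₁ - x₂‖ ≠ 0 := norm_ne_zero_iff.2 (sub_ne_zero.2 hne)
  obtain ⟨b, hb⟩ := Orthonormal.exists_orthonormalBasis_extension_of_card_eq
    (𝕜 := ℝ) (E := EuclideanSpace ℝ (Fin (m + 1))) (ι := Fin (m + 1)) (by simp)
    (v := fun _ => ‖x₁ - x₂‖⁻¹ • (x₁ - x₂)) (s := {0}) (by
      refine ⟨fun i => ?_, fun i j hij => (hij (Subsingleton.elim i j)).elim⟩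
      simp [norm_smul, hnorm])
  have hb₀ : x₁ - x₂ = dist x₁ x₂ • b 0 := by
    rw [hb 0 rfl, dist_eq_norm, smul_inv_smul₀ hnorm]
  have hrepr : b.repr (x₁ - x₂) = EuclideanSpace.single 0 (dist x₁ x₂) := by
    conv_lhs => rw [hb₀]
    ext i
    simp [b.repr_self]
  have hpres : MeasurePreserving (fun x => b.repr (x - x₂)) volume volume :=
    b.repr.measurePreserving.comp (measurePreserving_sub_right volume x₂)
  have hpre : Metric.ball x₁ 1 \ Metric.ball x₂ 1 = (fun x => b.repr (x - x₂)) ⁻¹'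
      (Metric.ball (EuclideanSpace.single 0 (dist x₁ x₂)) 1 \ Metric.ball 0 1) := by
    ext x
    simp only [← hrepr, Set.mem_sdiff, Set.mem_preimage, Metric.mem_ball, b.repr.dist_map,
      dist_sub_right, dist_zero_right, b.repr.norm_map, dist_eq_norm x x₂]
  rw [hpre, hpres.measure_preimage
    (measurableSet_ball.diff measurableSet_ball).nullMeasurableSet]
  exact EuclideanSpace.volume_ball_diff_ball_single_le m dist_nonneg
end

section
/- Let N ≥ 2, let 𝕃 := {(ξ,η) ∈ ℝ × ℝ^{N−1} : |η| < 1}, and define λ_{1,1} := inf { ∫ |∇u|² / ∫ u² : u smooth with compact support in the open unit ball B₁^{N−1} of ℝ^{N−1}, u not identically 0 }. If λ > −λ_{1,1}, then there exists a function W which is twice continuously differentiable on 𝕃 and continuous on the closure of 𝕃, such that inf_{x ∈ closure(𝕃)} W(x) > 0 and −ΔW(x) + λW(x) > 0 for every x ∈ 𝕃, where ΔW denotes the Laplacian (the trace of the Hessian) of W. -/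
open MeasureTheory

/-- The bottom of the Dirichlet spectrum of `-Δ` on an open set `U`, characterized as the
infimum of the Rayleigh quotient over nonzero smooth compactly supported functions in `U`. -/
noncomputable def rayleighQuotientInf {N : ℕ} (U : Set (EuclideanSpace ℝ (Fin N))) : ℝ :=
  ⨅ u : {u : EuclideanSpace ℝ (Fin N) → ℝ //
      ContDiff ℝ (⊤ : ℕ∞) u ∧ HasCompactSupport u ∧ tsupport u ⊆ U ∧ u ≠ 0},
    (∫ x, ‖fderiv ℝ u.1 x‖ ^ 2) / (∫ x, (u.1 x) ^ 2)

/-- The open cylinder `𝕃 = {(ξ, η) : |η| < 1}` of radius 1 around the first coordinate axis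
in `ℝ^N` (coordinate `0` is the `ξ`-axis, the remaining coordinates form `η`). -/
def cylinder (N : ℕ) : Set (EuclideanSpace ℝ (Fin N)) :=
  {x | ∑ i ∈ Finset.univ.filter (fun i : Fin N => (i : ℕ) ≠ 0), (x i) ^ 2 < 1}

/-- The Laplacian of `W`, the trace of the Hessian, i.e. the sum of the pure second partial
derivatives in the coordinate directions. -/
noncomputable def laplacian {N : ℕ} (W : EuclideanSpace ℝ (Fin N) → ℝ)
    (x : EuclideanSpace ℝ (Fin N)) : ℝ :=
  ∑ i : Fin N,
    iteratedFDeriv ℝ 2 W x ![EuclideanSpace.single i (1 : ℝ), EuclideanSpace.single i (1 : ℝ)]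

lemma norm_succ_mul_pow_le (a : ℕ → ℝ) {x R : ℝ} (hR : 1 ≤ R) (hx : |x| ≤ R) (k : ℕ) :
    ‖((k : ℝ) + 1) * a (k + 1) * x ^ k‖ ≤ |a (k + 1) * (2 * R) ^ (k + 1)| := by
  have h1 : ((k : ℝ) + 1) ≤ 2 ^ (k + 1) := by
    exact_mod_cast (Nat.lt_two_pow_self (n := k + 1)).le
  have h2 : |x| ^ k ≤ R ^ (k + 1) :=
    (pow_le_pow_left₀ (abs_nonneg x) hx k).trans (pow_le_pow_right₀ hR (Nat.le_succ k))
  have h3 : |(k : ℝ) + 1| = (k : ℝ) + 1 := abs_of_nonneg (by positivity)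
  have h4 : |(2 * R) ^ (k + 1)| = 2 ^ (k + 1) * R ^ (k + 1) := by
    rw [abs_of_nonneg (by positivity), mul_pow]
  rw [Real.norm_eq_abs, abs_mul, abs_mul, abs_mul, h3, h4, abs_pow]
  calc ((k : ℝ) + 1) * |a (k + 1)| * |x| ^ k = |a (k + 1)| * (((k : ℝ) + 1) * |x| ^ k) := by ring
    _ ≤ _ := by gcongr

lemma summable_deriv_power_series {a : ℕ → ℝ} (ha : ∀ x : ℝ, Summable fun k => a k * x ^ k)
    (x : ℝ) : Summable fun k : ℕ => ((k : ℝ) + 1) * a (k + 1) * x ^ k :=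
  Summable.of_norm_bounded
    ((summable_nat_add_iff 1).2 (ha (2 * max 1 |x|)).abs)
    fun k => norm_succ_mul_pow_le a (le_max_left _ _) (le_max_right _ _) k

lemma hasDerivAt_power_series {a : ℕ → ℝ} (ha : ∀ x : ℝ, Summable fun k => a k * x ^ k) (x : ℝ) :
    HasDerivAt (fun y => ∑' k, a k * y ^ k)
      (∑' k : ℕ, ((k : ℝ) + 1) * a (k + 1) * x ^ k) x := by
  set R : ℝ := |x| + 1
  have hR : 1 ≤ R := le_add_of_nonneg_left (abs_nonneg x)
  have key : HasDerivAt (fun y => ∑' k : ℕ, a (k + 1) * y ^ (k + 1))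
      (∑' k : ℕ, ((k : ℝ) + 1) * a (k + 1) * x ^ k) x := by
    have hs : Summable fun k : ℕ => |a (k + 1) * (2 * R) ^ (k + 1)| :=
      (summable_nat_add_iff (f := fun k => |a k * (2 * R) ^ k|) 1).2 (ha (2 * R)).abs
    refine hasDerivAt_tsum_of_isPreconnected (g := fun (k : ℕ) y => a (k + 1) * y ^ (k + 1))
      (g' := fun (k : ℕ) y => ((k : ℝ) + 1) * a (k + 1) * y ^ k) (t := Metric.ball 0 R) (y₀ := x)
      hs Metric.isOpen_ball
      (convex_ball (0 : ℝ) R).isPreconnected (fun k y _ => ?_) (fun k y hy => ?_) ?_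
      ((summable_nat_add_iff (f := fun k => a k * x ^ k) 1).2 (ha x)) ?_
    · have := (hasDerivAt_pow (k + 1) y).const_mul (a (k + 1))
      refine this.congr_deriv ?_
      push_cast
      ring
    · exact norm_succ_mul_pow_le a hR (by simpa using (mem_ball_zero_iff.1 hy).le) k
    · simp [R]
    · simp [R]
  have h0 : (fun y => ∑' k, a k * y ^ k) = fun y => a 0 + ∑' k : ℕ, a (k + 1) * y ^ (k + 1) := by
    funext y
    rw [(ha y).tsum_eq_zero_add]
    simp
  rw [h0]
  exact key.const_add (a 0)

lemma contDiff_power_series {a : ℕ → ℝ} (ha : ∀ x : ℝ, Summable fun k => a k * x ^ k) :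
    ContDiff ℝ (⊤ : ℕ∞) (fun y => ∑' k, a k * y ^ k) := by
  refine contDiff_infty.2 fun n => ?_
  induction n generalizing a with
  | zero =>
    exact contDiff_zero.2
      (Differentiable.continuous fun x => (hasDerivAt_power_series ha x).differentiableAt)
  | succ n ih =>
    push_cast
    refine contDiff_succ_iff_deriv.2
      ⟨fun x => (hasDerivAt_power_series ha x).differentiableAt, by simp, ?_⟩
    rw [funext fun x => (hasDerivAt_power_series ha x).deriv]
    exact ih fun x => summable_deriv_power_series ha x

/-- A function `F` on the line such that `x ↦ F (‖x‖ ^ 2)` is a smooth radial solution of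
`-Δφ = mu * φ` in dimension `n`, normalized by `φ 0 = 1`. -/
lemma exists_radial_eigenfunction {n : ℕ} (hn : 1 ≤ n) (mu : ℝ) :
    ∃ F : ℝ → ℝ, ContDiff ℝ (⊤ : ℕ∞) F ∧ F 0 = 1 ∧
      ∀ t, 4 * t * deriv (deriv F) t + 2 * n * deriv F t = -mu * F t := by
  set a : ℕ → ℝ := fun k => ∏ j ∈ Finset.range k, (-mu / ((j + 1) * (4 * j + 2 * n)))
  have hrec : ∀ k : ℕ, a (k + 1) * (((k : ℝ) + 1) * (4 * k + 2 * n)) = -mu * a k := by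
    intro k
    have hn' : (1 : ℝ) ≤ n := by exact_mod_cast hn
    have h : (4 * (k : ℝ) + 2 * n) ≠ 0 := by positivity
    have h' : (k : ℝ) + 1 ≠ 0 := by positivity
    have e : a (k + 1) = a k * (-mu / ((k + 1) * (4 * k + 2 * n))) := by
      simp only [a, Finset.prod_range_succ]
    rw [e, mul_assoc, div_mul_cancel₀ _ (mul_ne_zero h' h), mul_comm]
  have hbound : ∀ k : ℕ, |a k| ≤ |mu| ^ k / k.factorial := by
    intro k
    have hn' : (1 : ℝ) ≤ n := by exact_mod_cast hn
    induction k with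
    | zero => simp [a]
    | succ k ih =>
      have e : a (k + 1) = a k * (-mu / ((k + 1) * (4 * k + 2 * n))) := by
        simp only [a, Finset.prod_range_succ]
      have hk : (0 : ℝ) ≤ k := Nat.cast_nonneg k
      rw [e, abs_mul, abs_div, abs_neg, abs_of_pos (a := ((k : ℝ) + 1) * (4 * k + 2 * n))
        (by positivity), Nat.factorial_succ, pow_succ]
      push_cast
      calc |a k| * (|mu| / ((k + 1) * (4 * k + 2 * n)))
          ≤ |mu| ^ k / k.factorial * (|mu| / ((k + 1) * 1)) := by
            gcongr
            linarith
        _ = _ := by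
            field_simp
  have ha : ∀ x : ℝ, Summable fun k => a k * x ^ k := by
    intro x
    refine Summable.of_norm_bounded (Real.summable_pow_div_factorial (|mu| * |x|)) fun k => ?_
    rw [Real.norm_eq_abs, abs_mul, abs_pow, mul_pow, mul_div_right_comm]
    gcongr
    exact hbound k
  have d1 : deriv (fun y => ∑' k, a k * y ^ k) =
      fun x => ∑' k : ℕ, ((k : ℝ) + 1) * a (k + 1) * x ^ k :=
    funext fun x => (hasDerivAt_power_series ha x).deriv
  have s1 := summable_deriv_power_series ha
  refine ⟨fun y => ∑' k, a k * y ^ k, contDiff_power_series ha, ?_, fun t => ?_⟩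
  · change ∑' k, a k * (0 : ℝ) ^ k = 1
    rw [tsum_eq_single 0 (by intro k hk; simp [hk])]
    simp [a]
  · rw [d1, (hasDerivAt_power_series s1 t).deriv]
    have s2 := summable_deriv_power_series s1 t
    have s3 : Summable fun k : ℕ => (k : ℝ) * ((k : ℝ) + 1) * a (k + 1) * t ^ k := by
      refine (summable_nat_add_iff 1).1 ((s2.mul_left t).congr fun k => ?_)
      push_cast
      ring
    have e2 : t * ∑' k : ℕ, ((k : ℝ) + 1) * (((k + 1 : ℕ) : ℝ) + 1) * a (k + 1 + 1) * t ^ k =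
        ∑' k : ℕ, (k : ℝ) * ((k : ℝ) + 1) * a (k + 1) * t ^ k := by
      rw [s3.tsum_eq_zero_add, ← tsum_mul_left]
      simp only [Nat.cast_zero, zero_mul, zero_add]
      refine tsum_congr fun k => ?_
      push_cast
      ring
    simp only [← mul_assoc] at e2 ⊢
    rw [mul_assoc 4 t, e2, ← tsum_mul_left, ← tsum_mul_left, ← tsum_mul_left,
      ← (s3.mul_left 4).tsum_add ((s1 t).mul_left (2 * (n : ℝ)))]
    refine tsum_congr fun k => ?_
    linear_combination t ^ k * hrec k

lemma hasFDerivAt_comp_norm_sq {E : Type*} [NormedAddCommGroup E] [InnerProductSpace ℝ E]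
    {f : ℝ → ℝ} {f' : ℝ} {x : E} (hf : HasDerivAt f f' (‖x‖ ^ 2)) :
    HasFDerivAt (fun y : E => f (‖y‖ ^ 2)) ((2 * f') • innerSL ℝ x) x := by
  have := hf.comp_hasFDerivAt x (hasStrictFDerivAt_norm_sq x).hasFDerivAt
  refine this.congr_fderiv ?_
  ext v
  simp
  ring

lemma hasCompactSupport_comp_norm_sq {n : ℕ} {h : ℝ → ℝ} (h0 : ∀ t, 1 < t → h t = 0) :
    HasCompactSupport fun x : EuclideanSpace ℝ (Fin n) => h (‖x‖ ^ 2) := by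
  refine HasCompactSupport.intro (isCompact_closedBall 0 1) fun x hx => h0 _ ?_
  rw [mem_closedBall_zero_iff, not_le] at hx
  nlinarith

lemma integrable_comp_norm_sq {n : ℕ} {h : ℝ → ℝ} (hc : Continuous h)
    (h0 : ∀ t, 1 < t → h t = 0) :
    Integrable fun x : EuclideanSpace ℝ (Fin n) => h (‖x‖ ^ 2) :=
  Continuous.integrable_of_hasCompactSupport (by fun_prop) (hasCompactSupport_comp_norm_sq h0)

lemma deriv_eq_zero_of_eventually_zero {h : ℝ → ℝ} {T : ℝ} (h0 : ∀ t, T < t → h t = 0) {t : ℝ}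
    (ht : T < t) : deriv h t = 0 := by
  have : h =ᶠ[nhds t] fun _ => 0 := by
    filter_upwards [lt_mem_nhds ht] with s hs using h0 s hs
  rw [this.deriv_eq, deriv_const]

/-- The integral of the divergence of the radial vector field `x ↦ h (‖x‖ ^ 2) • x` vanishes. -/
lemma integral_divergence_radial {n : ℕ} {h : ℝ → ℝ} (hh : ContDiff ℝ 1 h)
    (h0 : ∀ t, 1 < t → h t = 0) :
    ∫ x : EuclideanSpace ℝ (Fin n), (n * h (‖x‖ ^ 2) + 2 * ‖x‖ ^ 2 * deriv h (‖x‖ ^ 2)) = 0 := by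
  have hd : Continuous (deriv h) := hh.continuous_deriv le_rfl
  have hd0 : ∀ t, 1 < t → deriv h t = 0 := fun t ht => deriv_eq_zero_of_eventually_zero h0 ht
  have hF : ∀ x : EuclideanSpace ℝ (Fin n), HasFDerivAt (fun y => h (‖y‖ ^ 2))
      ((2 * deriv h (‖x‖ ^ 2)) • innerSL ℝ x) x := fun x =>
    hasFDerivAt_comp_norm_sq ((hh.differentiable one_ne_zero) _).hasDerivAt
  have hcoord : ∀ (i : Fin n) (x : EuclideanSpace ℝ (Fin n)),
      HasFDerivAt (fun y : EuclideanSpace ℝ (Fin n) => y i)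
        (EuclideanSpace.proj i : EuclideanSpace ℝ (Fin n) →L[ℝ] ℝ) x := fun i x =>
    (EuclideanSpace.proj i : EuclideanSpace ℝ (Fin n) →L[ℝ] ℝ).hasFDerivAt
  have hint : ∀ i : Fin n, Integrable fun x : EuclideanSpace ℝ (Fin n) =>
      2 * deriv h (‖x‖ ^ 2) * x i * x i := fun i => by
    refine Continuous.integrable_of_hasCompactSupport (by fun_prop) ?_
    refine HasCompactSupport.mul_right (HasCompactSupport.mul_right ?_)
    exact (hasCompactSupport_comp_norm_sq hd0).mul_left
  have hinth := integrable_comp_norm_sq (n := n) hh.continuous h0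
  have key : ∀ i : Fin n, ∫ x : EuclideanSpace ℝ (Fin n), h (‖x‖ ^ 2) =
      -∫ x : EuclideanSpace ℝ (Fin n), 2 * deriv h (‖x‖ ^ 2) * x i * x i := by
    intro i
    have e := integral_mul_fderiv_eq_neg_fderiv_mul_of_integrable (μ := volume)
      (f := fun x : EuclideanSpace ℝ (Fin n) => h (‖x‖ ^ 2))
      (g := fun x : EuclideanSpace ℝ (Fin n) => x i) (v := EuclideanSpace.single i (1 : ℝ))
      (by
        simp only [(hF _).fderiv]
        simpa [EuclideanSpace.inner_single_right] using hint i)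
      (by
        simp only [(hcoord i _).fderiv]
        simpa using hinth)
      (Continuous.integrable_of_hasCompactSupport (by have := hh.continuous; fun_prop)
        (hasCompactSupport_comp_norm_sq h0).mul_right)
      (fun x _ => (hF x).differentiableAt)
      (fun x _ => (hcoord i x).differentiableAt)
    simp only [(hcoord i _).fderiv, (hF _).fderiv] at e
    simpa [EuclideanSpace.inner_single_right] using e
  have hsum : ∀ x : EuclideanSpace ℝ (Fin n),
      n * h (‖x‖ ^ 2) + 2 * ‖x‖ ^ 2 * deriv h (‖x‖ ^ 2) =
        ∑ i : Fin n, (h (‖x‖ ^ 2) + 2 * deriv h (‖x‖ ^ 2) * x i * x i) := by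
    intro x
    have hx : ‖x‖ ^ 2 = ∑ i, x i * x i := by
      rw [EuclideanSpace.norm_sq_eq]
      exact Finset.sum_congr rfl fun i _ => by rw [Real.norm_eq_abs, sq_abs, sq]
    rw [Finset.sum_add_distrib, Finset.sum_const, Finset.card_univ, Fintype.card_fin, nsmul_eq_mul]
    simp only [mul_assoc]
    rw [← Finset.mul_sum, ← Finset.mul_sum, ← hx]
    ring
  simp only [hsum]
  refine (integral_finsetSum _ fun i _ => hinth.add (hint i)).trans ?_
  refine Finset.sum_eq_zero fun i _ => (integral_add hinth (hint i)).trans ?_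
  rw [key i]
  ring

/-- The energy of a radial eigenfunction multiplied by a radial cutoff. -/
lemma integral_norm_fderiv_cutoff {n : ℕ} {mu : ℝ} {F S : ℝ → ℝ}
    (hF : ContDiff ℝ (⊤ : ℕ∞) F)
    (hode : ∀ t, 4 * t * deriv (deriv F) t + 2 * n * deriv F t = -mu * F t)
    (hS : ContDiff ℝ (⊤ : ℕ∞) S) (hS0 : ∀ t, 1 < t → S t = 0) :
    ∫ x : EuclideanSpace ℝ (Fin n),
        ‖fderiv ℝ (fun y : EuclideanSpace ℝ (Fin n) => F (‖y‖ ^ 2) * S (‖y‖ ^ 2)) x‖ ^ 2 =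
      mu * (∫ x : EuclideanSpace ℝ (Fin n), (F (‖x‖ ^ 2) * S (‖x‖ ^ 2)) ^ 2) +
        ∫ x : EuclideanSpace ℝ (Fin n),
          4 * ‖x‖ ^ 2 * (F (‖x‖ ^ 2) * deriv S (‖x‖ ^ 2)) ^ 2 := by
  have hF' : ContDiff ℝ (⊤ : ℕ∞) (deriv F) := (contDiff_infty_iff_deriv.1 hF).2
  have hS' : ContDiff ℝ (⊤ : ℕ∞) (deriv S) := (contDiff_infty_iff_deriv.1 hS).2
  have dF : ∀ t, HasDerivAt F (deriv F t) t := fun t =>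
    ((contDiff_infty_iff_deriv.1 hF).1 t).hasDerivAt
  have dF' : ∀ t, HasDerivAt (deriv F) (deriv (deriv F) t) t := fun t =>
    ((contDiff_infty_iff_deriv.1 hF').1 t).hasDerivAt
  have dS : ∀ t, HasDerivAt S (deriv S t) t := fun t =>
    ((contDiff_infty_iff_deriv.1 hS).1 t).hasDerivAt
  have cF := hF.continuous
  have cS := hS.continuous
  have cF' := hF'.continuous
  have cS' := hS'.continuous
  have hS'0 : ∀ t, 1 < t → deriv S t = 0 := fun t ht => deriv_eq_zero_of_eventually_zero hS0 ht
  set h : ℝ → ℝ := fun t => 2 * F t * S t ^ 2 * deriv F t with hdef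
  have hh : ContDiff ℝ 1 h := by
    have h1 : ContDiff ℝ 1 F := hF.of_le (by exact_mod_cast le_top)
    have h2 : ContDiff ℝ 1 S := hS.of_le (by exact_mod_cast le_top)
    have h3 : ContDiff ℝ 1 (deriv F) := hF'.of_le (by exact_mod_cast le_top)
    fun_prop
  have hh0 : ∀ t, 1 < t → h t = 0 := fun t ht => by simp [hdef, hS0 t ht]
  have dh : ∀ t, deriv h t = 2 * deriv F t ^ 2 * S t ^ 2 + 4 * F t * S t * deriv S t * deriv F t +
      2 * F t * S t ^ 2 * deriv (deriv F) t := fun t => by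
    have := ((((dF t).const_mul 2).mul ((dS t).pow 2)).mul (dF' t)).deriv
    refine Eq.trans this ?_
    simp
    ring
  have hdiv := integral_divergence_radial (n := n) hh hh0
  have hnorm : ∀ x : EuclideanSpace ℝ (Fin n),
      ‖fderiv ℝ (fun y : EuclideanSpace ℝ (Fin n) => F (‖y‖ ^ 2) * S (‖y‖ ^ 2)) x‖ ^ 2 =
        (n * h (‖x‖ ^ 2) + 2 * ‖x‖ ^ 2 * deriv h (‖x‖ ^ 2)) +
        (mu * (F (‖x‖ ^ 2) * S (‖x‖ ^ 2)) ^ 2 +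
          4 * ‖x‖ ^ 2 * (F (‖x‖ ^ 2) * deriv S (‖x‖ ^ 2)) ^ 2) := by
    intro x
    have e := (hasFDerivAt_comp_norm_sq (x := x) ((dF (‖x‖ ^ 2)).mul (dS (‖x‖ ^ 2)))).fderiv
    have e' : fderiv ℝ (fun y : EuclideanSpace ℝ (Fin n) => F (‖y‖ ^ 2) * S (‖y‖ ^ 2)) x = _ := e
    rw [e', norm_smul, innerSL_apply_norm, mul_pow, Real.norm_eq_abs, sq_abs, dh]
    linear_combination (F (‖x‖ ^ 2) * S (‖x‖ ^ 2) ^ 2) * (-hode (‖x‖ ^ 2))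
  have i1 : Integrable fun x : EuclideanSpace ℝ (Fin n) =>
      n * h (‖x‖ ^ 2) + 2 * ‖x‖ ^ 2 * deriv h (‖x‖ ^ 2) := by
    have := hh.continuous_deriv le_rfl
    have := hh.continuous
    refine integrable_comp_norm_sq (h := fun t => n * h t + 2 * t * deriv h t) (by fun_prop) ?_
    intro t ht
    simp [hh0 t ht, deriv_eq_zero_of_eventually_zero hh0 ht]
  have i2 : Integrable fun x : EuclideanSpace ℝ (Fin n) => (F (‖x‖ ^ 2) * S (‖x‖ ^ 2)) ^ 2 :=
    integrable_comp_norm_sq (h := fun t => (F t * S t) ^ 2) (by fun_prop)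
      fun t ht => by simp [hS0 t ht]
  have i3 : Integrable fun x : EuclideanSpace ℝ (Fin n) =>
      4 * ‖x‖ ^ 2 * (F (‖x‖ ^ 2) * deriv S (‖x‖ ^ 2)) ^ 2 :=
    integrable_comp_norm_sq (h := fun t => 4 * t * (F t * deriv S t) ^ 2) (by fun_prop)
      fun t ht => by simp [hS'0 t ht]
  simp only [hnorm]
  refine (integral_add i1 ((i2.const_mul mu).add i3)).trans ?_
  rw [hdiv, zero_add]
  refine (integral_add (i2.const_mul mu) i3).trans ?_
  rw [integral_const_mul]

lemma rayleighQuotientInf_mul_le {n : ℕ} {U : Set (EuclideanSpace ℝ (Fin n))}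
    {u : EuclideanSpace ℝ (Fin n) → ℝ} (hu : ContDiff ℝ (⊤ : ℕ∞) u) (hc : HasCompactSupport u)
    (hU : tsupport u ⊆ U) (hpos : 0 < ∫ x, u x ^ 2) :
    rayleighQuotientInf U * ∫ x, u x ^ 2 ≤ ∫ x, ‖fderiv ℝ u x‖ ^ 2 := by
  have h0 : u ≠ 0 := by
    rintro rfl
    simp at hpos
  rw [← le_div_iff₀ hpos]
  refine ciInf_le (f := fun u : {u : EuclideanSpace ℝ (Fin n) → ℝ //
      ContDiff ℝ (⊤ : ℕ∞) u ∧ HasCompactSupport u ∧ tsupport u ⊆ U ∧ u ≠ 0} =>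
    (∫ x, ‖fderiv ℝ u.1 x‖ ^ 2) / (∫ x, (u.1 x) ^ 2)) ⟨0, ?_⟩ ⟨u, hu, hc, hU, h0⟩
  rintro _ ⟨v, rfl⟩
  positivity

/-- The smooth cutoff equal to `0` for `t ≥ T - 1 / c` and to `1` for `t ≤ T - 2 / c`. -/
noncomputable def cutoffBelow (T c t : ℝ) : ℝ := Real.smoothTransition ((T - t) * c - 1)

lemma contDiff_cutoffBelow (T c : ℝ) : ContDiff ℝ (⊤ : ℕ∞) (cutoffBelow T c) :=
  Real.smoothTransition.contDiff.comp
    (((contDiff_const.sub contDiff_id).mul contDiff_const).sub contDiff_const)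

lemma cutoffBelow_eq_zero {T c t : ℝ} (h : (T - t) * c ≤ 1) : cutoffBelow T c t = 0 :=
  Real.smoothTransition.zero_of_nonpos (by linarith)

lemma cutoffBelow_mono {T c c' t : ℝ} (hc : 0 ≤ c) (h : c ≤ c') :
    cutoffBelow T c t ≤ cutoffBelow T c' t := by
  rcases le_total T t with ht | ht
  · rw [cutoffBelow_eq_zero (by nlinarith)]
    exact Real.smoothTransition.nonneg _
  · refine Real.smoothTransition.monotone ?_
    have := mul_le_mul_of_nonneg_left h (sub_nonneg.2 ht)
    linarith

lemma deriv_cutoffBelow (T c t : ℝ) :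
    deriv (cutoffBelow T c) t = -c * deriv Real.smoothTransition ((T - t) * c - 1) := by
  have h1 : HasDerivAt (fun t => (T - t) * c - 1) (-c) t := by
    simpa using (((hasDerivAt_id t).const_sub T).mul_const c).sub_const 1
  have h2 : HasDerivAt Real.smoothTransition (deriv Real.smoothTransition ((T - t) * c - 1))
      ((T - t) * c - 1) :=
    ((Real.smoothTransition.contDiff (n := 1)).differentiable one_ne_zero _).hasDerivAt
  have := (h2.comp t h1).deriv
  refine Eq.trans this (by ring)

lemma deriv_smoothTransition_of_neg {s : ℝ} (hs : s < 0) : deriv Real.smoothTransition s = 0 := by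
  have : Real.smoothTransition =ᶠ[nhds s] fun _ => 0 := by
    filter_upwards [gt_mem_nhds hs] with y hy using Real.smoothTransition.zero_of_nonpos hy.le
  rw [this.deriv_eq, deriv_const]

lemma deriv_smoothTransition_of_one_lt {s : ℝ} (hs : 1 < s) :
    deriv Real.smoothTransition s = 0 := by
  have : Real.smoothTransition =ᶠ[nhds s] fun _ => 1 := by
    filter_upwards [lt_mem_nhds hs] with y hy using Real.smoothTransition.one_of_one_le hy.le
  rw [this.deriv_eq, deriv_const]

lemma exists_abs_deriv_smoothTransition_le :
    ∃ K : ℝ, 0 ≤ K ∧ ∀ s, |deriv Real.smoothTransition s| ≤ K := by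
  have hc : Continuous (deriv Real.smoothTransition) :=
    (Real.smoothTransition.contDiff (n := 1)).continuous_deriv le_rfl
  obtain ⟨K, hK⟩ := (isCompact_Icc (a := (0 : ℝ)) (b := 1)).exists_bound_of_continuousOn
    hc.continuousOn
  have hK0 : 0 ≤ K := (norm_nonneg _).trans (hK 0 (by simp))
  refine ⟨K, hK0, fun s => ?_⟩
  by_cases h0 : s < 0
  · simpa [deriv_smoothTransition_of_neg h0] using hK0
  by_cases h1 : 1 < s
  · simpa [deriv_smoothTransition_of_one_lt h1] using hK0
  · exact hK s ⟨not_lt.1 h0, not_lt.1 h1⟩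

/-- A function vanishing at `T` times the derivative of the cutoff below `T` stays bounded as the
cutoff layer shrinks. -/
lemma exists_abs_mul_deriv_cutoffBelow_le {F : ℝ → ℝ} (hF : ContDiff ℝ 1 F) {T : ℝ}
    (hT : T ∈ Set.Icc (0 : ℝ) 1) (hFT : F T = 0) :
    ∃ M : ℝ, ∀ c, 0 < c → ∀ t, 0 ≤ t → |F t * deriv (cutoffBelow T c) t| ≤ M := by
  obtain ⟨K, hK0, hK⟩ := exists_abs_deriv_smoothTransition_le
  obtain ⟨C, hC⟩ := (isCompact_Icc (a := (0 : ℝ)) (b := 1)).exists_bound_of_continuousOn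
    (hF.continuous_deriv le_rfl).continuousOn
  have hC0 : 0 ≤ C := (norm_nonneg _).trans (hC 0 (by simp))
  refine ⟨C * (2 * K), fun c hc t ht => ?_⟩
  rw [deriv_cutoffBelow]
  set s := (T - t) * c - 1 with hs
  by_cases h0 : s < 0
  · rw [deriv_smoothTransition_of_neg h0]
    simp only [mul_zero, abs_zero]
    positivity
  by_cases h1 : 1 < s
  · rw [deriv_smoothTransition_of_one_lt h1]
    simp only [mul_zero, abs_zero]
    positivity
  rw [not_lt] at h0 h1
  have htT : 0 ≤ T - t := by
    by_contra! h
    nlinarith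
  have hFt : |F t| ≤ C * (T - t) := by
    have := Convex.norm_image_sub_le_of_norm_deriv_le (f := F) (C := C) (s := Set.Icc (0 : ℝ) 1)
      (x := T) (y := t) (fun x _ => hF.differentiable one_ne_zero x) hC (convex_Icc 0 1) hT
      ⟨ht, by linarith [hT.2]⟩
    rw [hFT, sub_zero, Real.norm_eq_abs, Real.norm_eq_abs, abs_sub_comm, abs_of_nonneg htT] at this
    exact this
  rw [abs_mul, abs_mul, abs_neg, abs_of_pos hc]
  calc |F t| * (c * |deriv Real.smoothTransition s|)
      ≤ C * (T - t) * (c * K) := by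
        gcongr
        exact hK s
    _ = C * ((T - t) * c * K) := by ring
    _ ≤ C * (2 * K) := by
        gcongr
        linarith

lemma radial_eigenfunction_ne_zero {n : ℕ} {mu : ℝ} {F : ℝ → ℝ}
    (hmu : mu < rayleighQuotientInf (Metric.ball (0 : EuclideanSpace ℝ (Fin n)) 1))
    (hF : ContDiff ℝ (⊤ : ℕ∞) F) (hF0 : F 0 = 1)
    (hode : ∀ t, 4 * t * deriv (deriv F) t + 2 * n * deriv F t = -mu * F t)
    {T : ℝ} (hT : T ∈ Set.Icc (0 : ℝ) 1) : F T ≠ 0 := by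
  intro hFT
  have hTpos : 0 < T := lt_of_le_of_ne hT.1 (by rintro rfl; simp [hF0] at hFT)
  obtain ⟨M, hM⟩ := exists_abs_mul_deriv_cutoffBelow_le
    (hF.of_le (by exact_mod_cast le_top)) hT hFT
  set lam := rayleighQuotientInf (Metric.ball (0 : EuclideanSpace ℝ (Fin n)) 1)
  set c : ℕ → ℝ := fun k => (k + 2) / T with hcdef
  have hc : ∀ k, 0 < c k := fun k => by positivity
  have hc0 : ∀ k, c 0 ≤ c k := fun k => by
    simp only [hcdef]
    gcongr
    simp
  have hS0 : ∀ k t, T < t → cutoffBelow T (c k) t = 0 := fun k t ht =>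
    cutoffBelow_eq_zero (by nlinarith [hc k])
  have hS1 : ∀ k t, 1 < t → cutoffBelow T (c k) t = 0 := fun k t ht =>
    hS0 k t (hT.2.trans_lt ht)
  have hSs : ∀ k, ContDiff ℝ (⊤ : ℕ∞) (cutoffBelow T (c k)) := fun k => contDiff_cutoffBelow _ _
  have cF := hF.continuous
  have cS : ∀ k, Continuous (cutoffBelow T (c k)) := fun k => (hSs k).continuous
  have cS' : ∀ k, Continuous (deriv (cutoffBelow T (c k))) := fun k =>
    (contDiff_infty_iff_deriv.1 (hSs k)).2.continuous
  set m : ℕ → ℝ := fun k => ∫ x : EuclideanSpace ℝ (Fin n),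
    (F (‖x‖ ^ 2) * cutoffBelow T (c k) (‖x‖ ^ 2)) ^ 2
  set g : ℕ → EuclideanSpace ℝ (Fin n) → ℝ := fun k x =>
    4 * ‖x‖ ^ 2 * (F (‖x‖ ^ 2) * deriv (cutoffBelow T (c k)) (‖x‖ ^ 2)) ^ 2 with hg
  have hm0 : 0 < m 0 := by
    refine Continuous.integral_pos_of_hasCompactSupport_nonneg_nonzero (x := 0) ?_ ?_
      (fun x => sq_nonneg _) ?_
    · have := cS 0
      fun_prop
    · exact hasCompactSupport_comp_norm_sq
        (h := fun t => (F t * cutoffBelow T (c 0) t) ^ 2) fun t ht => by simp [hS1 0 t ht]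
    · have : T * c 0 = 2 := by
        simp only [hcdef]
        field_simp
        norm_num
      simp [hF0, cutoffBelow, this]
  have hmk : ∀ k, m 0 ≤ m k := by
    intro k
    have hi : ∀ k, Integrable fun x : EuclideanSpace ℝ (Fin n) =>
        (F (‖x‖ ^ 2) * cutoffBelow T (c k) (‖x‖ ^ 2)) ^ 2 := fun k => by
      have := cS k
      exact integrable_comp_norm_sq (h := fun t => (F t * cutoffBelow T (c k) t) ^ 2)
        (by fun_prop) fun t ht => by simp [hS1 k t ht]
    refine integral_mono (hi 0) (hi k) fun x => ?_
    simp only [mul_pow]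
    gcongr
    · exact Real.smoothTransition.nonneg _
    · exact cutoffBelow_mono (hc 0).le (hc0 k)
  have hle : ∀ k, (lam - mu) * m 0 ≤ ∫ x, g k x := by
    intro k
    have hen := integral_norm_fderiv_cutoff (n := n) hF hode (hSs k) (hS1 k)
    have hray := rayleighQuotientInf_mul_le
      (U := Metric.ball (0 : EuclideanSpace ℝ (Fin n)) 1)
      (u := fun y => F (‖y‖ ^ 2) * cutoffBelow T (c k) (‖y‖ ^ 2))
      ((hF.comp (contDiff_norm_sq ℝ)).mul ((hSs k).comp (contDiff_norm_sq ℝ)))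
      (hasCompactSupport_comp_norm_sq (h := fun t => F t * cutoffBelow T (c k) t)
        fun t ht => by simp [hS1 k t ht])
      ?_ (hm0.trans_le (hmk k))
    · rw [hen] at hray
      have h1 : (lam - mu) * m 0 ≤ (lam - mu) * m k :=
        mul_le_mul_of_nonneg_left (hmk k) (sub_nonneg.2 hmu.le)
      have h2 : lam * m k ≤ mu * m k + ∫ x, g k x := hray
      linarith
    · have hcl : IsClosed {x : EuclideanSpace ℝ (Fin n) | ‖x‖ ^ 2 ≤ T - 1 / c k} :=
        isClosed_le (by fun_prop) continuous_const
      refine (closure_minimal (fun x hx => ?_) hcl).trans fun x hx => ?_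
      · by_contra h
        have h' : T - 1 / c k < ‖x‖ ^ 2 := not_le.1 h
        refine hx ?_
        have : (T - ‖x‖ ^ 2) * c k ≤ 1 := by
          rw [← le_div_iff₀ (hc k)]
          linarith
        simp [cutoffBelow_eq_zero this]
      · have hx' : ‖x‖ ^ 2 ≤ T - 1 / c k := hx
        have : 0 < 1 / c k := one_div_pos.2 (hc k)
        rw [mem_ball_zero_iff]
        nlinarith [hT.2, norm_nonneg x]
  have hlim : Filter.Tendsto (fun k => ∫ x, g k x) Filter.atTop (nhds 0) := by
    have hd0 : ∀ k t, 1 < t → deriv (cutoffBelow T (c k)) t = 0 := fun k t ht =>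
      deriv_eq_zero_of_eventually_zero (hS1 k) ht
    have := tendsto_integral_of_dominated_convergence (μ := volume) (F := g)
      (f := fun _ : EuclideanSpace ℝ (Fin n) => (0 : ℝ))
      ((Metric.closedBall (0 : EuclideanSpace ℝ (Fin n)) 1).indicator fun _ => 4 * M ^ 2)
      (fun k => ?_) ?_ (fun k => ?_) ?_
    · simpa using this
    · have := cS' k
      exact Continuous.aestronglyMeasurable (by fun_prop)
    · exact (integrable_indicator_iff measurableSet_closedBall).2
        (integrableOn_const (isCompact_closedBall _ _).measure_lt_top.ne)
    · refine Filter.Eventually.of_forall fun x => ?_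
      by_cases hx : ‖x‖ ≤ 1
      · rw [Set.indicator_of_mem (mem_closedBall_zero_iff.2 hx),
          Real.norm_of_nonneg (by positivity)]
        have h1 := hM (c k) (hc k) (‖x‖ ^ 2) (by positivity)
        have h2 : (F (‖x‖ ^ 2) * deriv (cutoffBelow T (c k)) (‖x‖ ^ 2)) ^ 2 ≤ M ^ 2 :=
          sq_le_sq' (by linarith [neg_le_of_abs_le h1]) (le_of_abs_le h1)
        have h3 : ‖x‖ ^ 2 ≤ 1 := pow_le_one₀ (norm_nonneg x) hx
        calc g k x ≤ 4 * 1 * M ^ 2 := by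
              simp only [hg]
              gcongr
          _ = 4 * M ^ 2 := by ring
      · rw [Set.indicator_of_notMem (by rwa [mem_closedBall_zero_iff])]
        have : 1 < ‖x‖ ^ 2 := by nlinarith
        simp [hg, hd0 k _ this]
    · refine Filter.Eventually.of_forall fun x => ?_
      refine tendsto_const_nhds.congr' ?_
      have : ∀ᶠ k in Filter.atTop, deriv (cutoffBelow T (c k)) (‖x‖ ^ 2) = 0 := by
        rcases le_or_gt T (‖x‖ ^ 2) with h | h
        · refine Filter.Eventually.of_forall fun k => ?_
          rw [deriv_cutoffBelow, deriv_smoothTransition_of_neg (by nlinarith [hc k]), mul_zero]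
        · have ht : Filter.Tendsto (fun k => (T - ‖x‖ ^ 2) * c k) Filter.atTop Filter.atTop :=
            ((Filter.tendsto_atTop_add_const_right _ 2
              tendsto_natCast_atTop_atTop).atTop_div_const hTpos).const_mul_atTop (sub_pos.2 h)
          filter_upwards [ht.eventually_gt_atTop 2] with k hk
          rw [deriv_cutoffBelow, deriv_smoothTransition_of_one_lt (by linarith), mul_zero]
      filter_upwards [this] with k hk
      simp [hg, hk]
  have := ge_of_tendsto' hlim hle
  have h2 := mul_pos (sub_pos.2 hmu) hm0
  linarith

lemma laplacian_comp_sum_sq {N : ℕ} (s : Finset (Fin N)) {F : ℝ → ℝ}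
    (hF : ContDiff ℝ (⊤ : ℕ∞) F) (x : EuclideanSpace ℝ (Fin N)) :
    laplacian (fun y : EuclideanSpace ℝ (Fin N) => F (∑ i ∈ s, y i ^ 2)) x =
      4 * (∑ i ∈ s, x i ^ 2) * deriv (deriv F) (∑ i ∈ s, x i ^ 2) +
        2 * s.card * deriv F (∑ i ∈ s, x i ^ 2) := by
  have hF' : ContDiff ℝ (⊤ : ℕ∞) (deriv F) := (contDiff_infty_iff_deriv.1 hF).2
  have dF : ∀ t, HasDerivAt F (deriv F t) t := fun t =>
    ((contDiff_infty_iff_deriv.1 hF).1 t).hasDerivAt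
  have dF' : ∀ t, HasDerivAt (deriv F) (deriv (deriv F) t) t := fun t =>
    ((contDiff_infty_iff_deriv.1 hF').1 t).hasDerivAt
  have hcoord : ∀ (i : Fin N) (y : EuclideanSpace ℝ (Fin N)),
      HasFDerivAt (fun y : EuclideanSpace ℝ (Fin N) => y i)
        (EuclideanSpace.proj i : EuclideanSpace ℝ (Fin N) →L[ℝ] ℝ) y := fun i y =>
    (EuclideanSpace.proj i : EuclideanSpace ℝ (Fin N) →L[ℝ] ℝ).hasFDerivAt
  have hq : ∀ y : EuclideanSpace ℝ (Fin N),
      HasFDerivAt (fun y : EuclideanSpace ℝ (Fin N) => ∑ i ∈ s, y i ^ 2)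
        (∑ i ∈ s, (2 * y i) • (EuclideanSpace.proj i : EuclideanSpace ℝ (Fin N) →L[ℝ] ℝ)) y :=
    fun y => HasFDerivAt.fun_sum fun i _ => by simpa using (hcoord i y).pow 2
  have hqv : ∀ (y : EuclideanSpace ℝ (Fin N)) (i : Fin N),
      (∑ j ∈ s, (2 * y j) • (EuclideanSpace.proj j : EuclideanSpace ℝ (Fin N) →L[ℝ] ℝ))
        (EuclideanSpace.single i (1 : ℝ)) = if i ∈ s then 2 * y i else 0 := by
    intro y i
    simp
  have hW : ContDiff ℝ (⊤ : ℕ∞)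
      (fun y : EuclideanSpace ℝ (Fin N) => F (∑ i ∈ s, y i ^ 2)) :=
    hF.comp (by fun_prop)
  have hfd : ∀ (i : Fin N) (y : EuclideanSpace ℝ (Fin N)),
      fderiv ℝ (fun y : EuclideanSpace ℝ (Fin N) => F (∑ i ∈ s, y i ^ 2)) y
        (EuclideanSpace.single i (1 : ℝ)) =
          deriv F (∑ j ∈ s, y j ^ 2) * if i ∈ s then 2 * y i else 0 := by
    intro i y
    have e : fderiv ℝ (fun y : EuclideanSpace ℝ (Fin N) => F (∑ i ∈ s, y i ^ 2)) y = _ :=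
      ((dF _).comp_hasFDerivAt y (hq y)).fderiv
    rw [e, smul_apply, hqv, smul_eq_mul]
  have hfd2 : Differentiable ℝ
      (fderiv ℝ (fun y : EuclideanSpace ℝ (Fin N) => F (∑ i ∈ s, y i ^ 2))) :=
    ((contDiff_infty.1 hW 2).fderiv_right (m := 1) le_rfl).differentiable one_ne_zero
  have hterm : ∀ i : Fin N,
      iteratedFDeriv ℝ 2 (fun y : EuclideanSpace ℝ (Fin N) => F (∑ i ∈ s, y i ^ 2)) x
        ![EuclideanSpace.single i (1 : ℝ), EuclideanSpace.single i (1 : ℝ)] =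
      if i ∈ s then 4 * deriv (deriv F) (∑ j ∈ s, x j ^ 2) * x i ^ 2 +
        2 * deriv F (∑ j ∈ s, x j ^ 2) else 0 := by
    intro i
    rw [iteratedFDeriv_two_apply]
    have e1 := ((hfd2 x).hasFDerivAt.clm_apply
      (hasFDerivAt_const (EuclideanSpace.single i (1 : ℝ)) x)).fderiv
    simp only [hfd] at e1
    have e2 := DFunLike.congr_fun e1 (EuclideanSpace.single i (1 : ℝ))
    simp only [Matrix.cons_val_zero, Matrix.cons_val_one]
    by_cases hi : i ∈ s
    · simp only [hi, if_true] at e2 ⊢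
      have e3 := (((dF' _).comp_hasFDerivAt x (hq x)).mul ((hcoord i x).const_mul 2)).fderiv
      have e4 : fderiv ℝ (fun y : EuclideanSpace ℝ (Fin N) =>
        deriv F (∑ j ∈ s, y j ^ 2) * (2 * y i)) x = _ := e3
      rw [e4] at e2
      simp only [add_apply, smul_apply, hqv, hi] at e2
      simp at e2
      rw [← e2]
      ring
    · simp only [hi, if_false, mul_zero] at e2 ⊢
      simpa using e2.symm
  rw [laplacian, Finset.sum_congr rfl fun i _ => hterm i, Finset.sum_ite_mem, Finset.univ_inter,
    Finset.sum_add_distrib, ← Finset.mul_sum, Finset.sum_const, nsmul_eq_mul]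
  ring

theorem stmt_13 (N : ℕ) (hN : 2 ≤ N) (lam : ℝ)
    (hlam : -(rayleighQuotientInf (Metric.ball (0 : EuclideanSpace ℝ (Fin (N - 1))) 1)) < lam) :
    ∃ W : EuclideanSpace ℝ (Fin N) → ℝ,
      ContDiffOn ℝ 2 W (cylinder N) ∧
      ContinuousOn W (closure (cylinder N)) ∧
      (∃ c > (0 : ℝ), ∀ x ∈ closure (cylinder N), c ≤ W x) ∧
      ∀ x ∈ cylinder N, 0 < -laplacian W x + lam * W x := by
  obtain ⟨mu, hmu1, hmu2⟩ := exists_between (neg_lt.1 hlam)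
  obtain ⟨F, hF, hF0, hode⟩ := exists_radial_eigenfunction (n := N - 1) (by omega) mu
  have hne : ∀ t ∈ Set.Icc (0 : ℝ) 1, F t ≠ 0 := fun t ht =>
    radial_eigenfunction_ne_zero hmu2 hF hF0 hode ht
  have hpos : ∀ t ∈ Set.Icc (0 : ℝ) 1, 0 < F t := by
    intro t ht
    by_contra! h
    obtain ⟨s, hs, hs0⟩ := intermediate_value_Icc' ht.1 hF.continuous.continuousOn
      (show (0 : ℝ) ∈ Set.Icc (F t) (F 0) from ⟨h, by rw [hF0]; exact zero_le_one⟩)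
    exact hne s ⟨hs.1, hs.2.trans ht.2⟩ hs0
  obtain ⟨t₀, ht₀, hmin⟩ := isCompact_Icc.exists_isMinOn (Set.nonempty_Icc.2 zero_le_one)
    (hF.continuous.continuousOn (s := Set.Icc (0 : ℝ) 1))
  set s : Finset (Fin N) := Finset.univ.filter fun i : Fin N => (i : ℕ) ≠ 0 with hs
  have hcard : s.card = N - 1 := by
    have : s = Finset.univ.erase ⟨0, by omega⟩ := by
      ext i
      simp [hs, Fin.ext_iff]
    rw [this, Finset.card_erase_of_mem (Finset.mem_univ _), Finset.card_univ, Fintype.card_fin]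
  have hW : ContDiff ℝ (⊤ : ℕ∞)
      (fun y : EuclideanSpace ℝ (Fin N) => F (∑ i ∈ s, y i ^ 2)) :=
    hF.comp (by fun_prop)
  have hcl : ∀ x ∈ closure (cylinder N), ∑ i ∈ s, x i ^ 2 ∈ Set.Icc (0 : ℝ) 1 := by
    intro x hx
    refine ⟨Finset.sum_nonneg fun i _ => sq_nonneg _, ?_⟩
    have hc : IsClosed {x : EuclideanSpace ℝ (Fin N) | ∑ i ∈ s, x i ^ 2 ≤ 1} :=
      isClosed_le (by fun_prop) continuous_const
    have hsub : cylinder N ⊆ {x | ∑ i ∈ s, x i ^ 2 ≤ 1} := fun y hy =>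
      le_of_lt (show ∑ i ∈ s, y i ^ 2 < 1 from hy)
    exact closure_minimal hsub hc hx
  refine ⟨fun y => F (∑ i ∈ s, y i ^ 2), (contDiff_infty.1 hW 2).contDiffOn,
    hW.continuous.continuousOn, ⟨F t₀, hpos t₀ ht₀, fun x hx => hmin (hcl x hx)⟩, fun x hx => ?_⟩
  have hx0 := hpos _ (hcl x (subset_closure hx))
  rw [laplacian_comp_sum_sq s hF, hcard, hode]
  have := mul_pos (by linarith : 0 < mu + lam) hx0
  linarith
end
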